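/- arXiv:1306.3770 — 2 statements merged into one kernel-verified Lean document; each statement's English description precedes it below -/
import Mathlib

section
/- Let n, m be positive integers and let (X_{ij}) and (Y_{ij}), 1 ≤ i ≤ n, 1 ≤ j ≤ m, be two centered jointly Gaussian families of real random variables which satisfy, for all choices of indices: (1) E[X_{ij}²] = E[Y_{ij}²]; (2) E[X_{ij}X_{ik}] ≥ E[Y_{ij}Y_{ik}]; (3) E[X_{ij}X_{lk}] ≤ E[Y_{ij}Y_{lk}] whenever i ≠ l. Then for every nondecreasing function ψ : ℝ → ℝ (for which all the expectations below exist), E[min_{1≤i≤n} max_{1≤j≤m} ψ(X_{ij})] ≤ E[min_{1≤i≤n} max_{1≤j≤m} ψ(Y_{ij})]. -/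
open MeasureTheory ProbabilityTheory

/-- A finite family of real random variables is centered jointly Gaussian if every
(finite) linear combination of its members is a mean-zero Gaussian random variable. -/
def IsCenteredGaussianFamily {Ω ι : Type*} [MeasureSpace Ω] [Fintype ι]
    (X : ι → Ω → ℝ) : Prop :=
  ∀ c : ι → ℝ, ∃ v : NNReal,
    Measure.map (fun ω => ∑ i, c i * X i ω) (volume : Measure Ω) = gaussianReal 0 v

open MeasureTheory ProbabilityTheory Filter Topology

namespace Gordon

variable {ι : Type*} [Fintype ι]

/-- linear form -/
noncomputable def lin (D : ι → ℝ) (v : EuclideanSpace ℝ ι) : ℝ := ∑ p, D p * v p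

/-- half quadratic form -/
noncomputable def quad (H : ι → ι → ℝ) (v : EuclideanSpace ℝ ι) : ℝ :=
  (1 / 2) * ∑ p, ∑ q, H p q * (v p * v q)

/-- explicit second-order jets with uniform remainder -/
structure IsJet (f : EuclideanSpace ℝ ι → ℝ) (D : EuclideanSpace ℝ ι → ι → ℝ)
    (H : EuclideanSpace ℝ ι → ι → ι → ℝ) : Prop where
  cont : Continuous f
  ex : ∃ K : ℝ, 0 ≤ K ∧ ∀ u v, |f u| ≤ K ∧ |lin (D u) v| ≤ K * ‖v‖ ∧ |quad (H u) v| ≤ K * ‖v‖ ^ 2 ∧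
    |f (u + v) - f u| ≤ K * ‖v‖ ∧ |f (u + v) - f u - lin (D u) v| ≤ K * ‖v‖ ^ 2 ∧
    |f (u + v) - f u - lin (D u) v - quad (H u) v| ≤ K * ‖v‖ ^ 3

lemma lin_mul (a b : ℝ) (D D' : ι → ℝ) (v : EuclideanSpace ℝ ι) :
    lin (fun p => a * D p + b * D' p) v = a * lin D v + b * lin D' v := by
  simp only [lin, Finset.mul_sum, ← Finset.sum_add_distrib]
  exact Finset.sum_congr rfl fun _ _ => by ring

lemma quad_mul (a b : ℝ) (H H' : ι → ι → ℝ) (D D' : ι → ℝ) (v : EuclideanSpace ℝ ι) :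
    quad (fun p q => a * H p q + b * H' p q + (D p * D' q + D' p * D q)) v
      = a * quad H v + b * quad H' v + lin D v * lin D' v := by
  have e1 : lin D v * lin D' v = ∑ p, ∑ q, D p * v p * (D' q * v q) := by
    rw [lin, lin, Finset.sum_mul_sum]
  have e2 : lin D v * lin D' v = ∑ p, ∑ q, D' p * v p * (D q * v q) := by
    rw [mul_comm, lin, lin, Finset.sum_mul_sum]
  have e3 : lin D v * lin D' v = (1/2) * (∑ p, ∑ q, D p * v p * (D' q * v q))
      + (1/2) * ∑ p, ∑ q, D' p * v p * (D q * v q) := by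
    rw [← e1, ← e2]; ring
  rw [e3]
  simp only [quad, Finset.mul_sum, ← Finset.sum_add_distrib]
  exact Finset.sum_congr rfl fun _ _ => Finset.sum_congr rfl fun _ _ => by ring

lemma abs_mul_le' {a b A B : ℝ} (ha : |a| ≤ A) (hb : |b| ≤ B) : |a * b| ≤ A * B := by
  rw [abs_mul]; exact mul_le_mul ha hb (abs_nonneg _) ((abs_nonneg _).trans ha)

lemma IsJet.mul {f g : EuclideanSpace ℝ ι → ℝ} {D D' H H'} (hf : IsJet f D H) (hg : IsJet g D' H') :
    IsJet (fun u => f u * g u) (fun u p => g u * D u p + f u * D' u p)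
      (fun u p q => g u * H u p q + f u * H' u p q + (D u p * D' u q + D' u p * D u q)) := by
  refine ⟨hf.cont.mul hg.cont, ?_⟩
  obtain ⟨K, hK, h⟩ := hf.ex
  obtain ⟨L, hL, h'⟩ := hg.ex
  refine ⟨4 * (K * L), by positivity, fun u v => ?_⟩
  obtain ⟨a0, a1, a2, a3, a4, a5⟩ := h u v
  obtain ⟨b0, b1, b2, b3, b4, b5⟩ := h' u v
  obtain ⟨c0, -⟩ := h (u + v) v
  rw [lin_mul, quad_mul]
  set n := ‖v‖
  have hn : 0 ≤ n := norm_nonneg _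
  generalize f (u + v) = F at *
  generalize f u = f0 at *
  generalize g (u + v) = G at *
  generalize g u = g0 at *
  generalize lin (D u) v = df at *
  generalize lin (D' u) v = dg at *
  generalize quad (H u) v = hf at *
  generalize quad (H' u) v = hg at *
  have hKL : 0 ≤ K * L := by positivity
  have p1 : 0 ≤ K * L * n := by positivity
  have p2 : 0 ≤ K * L * n ^ 2 := by positivity
  have p3 : 0 ≤ K * L * n ^ 3 := by positivity
  refine ⟨?_, ?_, ?_, ?_, ?_, ?_⟩
  · have := abs_mul_le' a0 b0; linarith
  · have t1 := abs_mul_le' b0 a1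
    have t2 := abs_mul_le' a0 b1
    have := abs_add_le (g0 * df) (f0 * dg)
    nlinarith
  · have t1 := abs_mul_le' b0 a2
    have t2 := abs_mul_le' a0 b2
    have t3 := abs_mul_le' a1 b1
    have := abs_add_le (g0 * hf + f0 * hg) (df * dg)
    have := abs_add_le (g0 * hf) (f0 * hg)
    nlinarith
  · have t1 := abs_mul_le' c0 b3
    have t2 := abs_mul_le' b0 a3
    have := abs_add_le (F * (G - g0)) (g0 * (F - f0))
    rw [show F * G - f0 * g0 = F * (G - g0) + g0 * (F - f0) by ring]
    nlinarith
  · have t1 := abs_mul_le' c0 b4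
    have t2 := abs_mul_le' b0 a4
    have t3 := abs_mul_le' a3 b1
    have := abs_add_le (F * (G - g0 - dg) + g0 * (F - f0 - df)) ((F - f0) * dg)
    have := abs_add_le (F * (G - g0 - dg)) (g0 * (F - f0 - df))
    rw [show F * G - f0 * g0 - (g0 * df + f0 * dg) =
      F * (G - g0 - dg) + g0 * (F - f0 - df) + (F - f0) * dg by ring]
    nlinarith
  · have t1 := abs_mul_le' c0 b5
    have t2 := abs_mul_le' b0 a5
    have t3 := abs_mul_le' a4 b1
    have t4 := abs_mul_le' a3 b2
    have := abs_add_le (F * (G - g0 - dg - hg) + g0 * (F - f0 - df - hf) + (F - f0 - df) * dg)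
      ((F - f0) * hg)
    have := abs_add_le (F * (G - g0 - dg - hg) + g0 * (F - f0 - df - hf)) ((F - f0 - df) * dg)
    have := abs_add_le (F * (G - g0 - dg - hg)) (g0 * (F - f0 - df - hf))
    rw [show F * G - f0 * g0 - (g0 * df + f0 * dg) - (g0 * hf + f0 * hg + df * dg) =
      F * (G - g0 - dg - hg) + g0 * (F - f0 - df - hf) + (F - f0 - df) * dg
      + (F - f0) * hg by ring]
    nlinarith

lemma IsJet.one : IsJet (fun _ : EuclideanSpace ℝ ι => (1 : ℝ)) (fun _ _ => 0) (fun _ _ _ => 0) := by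
  refine ⟨continuous_const, 1, zero_le_one, fun u v => ?_⟩
  have : 0 ≤ ‖v‖ := norm_nonneg v
  simp [lin, quad, this]

lemma IsJet.one_sub {f : EuclideanSpace ℝ ι → ℝ} {D H} (hf : IsJet f D H) :
    IsJet (fun u => 1 - f u) (fun u p => - D u p) (fun u p q => - H u p q) := by
  refine ⟨continuous_const.sub hf.cont, ?_⟩
  obtain ⟨K, hK, h⟩ := hf.ex
  refine ⟨K + 1, by positivity, fun u v => ?_⟩
  obtain ⟨a0, a1, a2, a3, a4, a5⟩ := h u v
  have e1 : lin (fun p => - D u p) v = - lin (D u) v := by simp [lin]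
  have e2 : quad (fun p q => - H u p q) v = - quad (H u) v := by simp [quad]
  rw [e1, e2]
  have hn : 0 ≤ ‖v‖ := norm_nonneg v
  have hn2 : 0 ≤ ‖v‖ ^ 2 := by positivity
  have hn3 : 0 ≤ ‖v‖ ^ 3 := by positivity
  refine ⟨?_, ?_, ?_, ?_, ?_, ?_⟩
  · rw [abs_le] at *; constructor <;> linarith
  · rw [abs_neg]; linarith
  · rw [abs_neg]; linarith
  · rw [abs_le] at *; constructor <;> linarith
  · rw [abs_le] at *; constructor <;> linarith
  · rw [abs_le] at *; constructor <;> linarith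

lemma integ_bound {r ρ : ℝ → ℝ} {C : ℝ} {n : ℕ} (hC : 0 ≤ C) (h0 : r 0 = 0)
    (hd : ∀ s, HasDerivAt r (ρ s) s)
    (hb : ∀ s, |ρ s| ≤ C * |s| ^ n) (s : ℝ) : |r s| ≤ C * |s| ^ (n + 1) := by
  have := Convex.norm_image_sub_le_of_norm_hasDerivWithin_le (f := r) (f' := ρ)
    (s := Set.Icc (-|s|) |s|) (x := 0) (y := s) (C := C * |s| ^ n)
    (fun x _ => (hd x).hasDerivWithinAt)
    (fun x hx => (hb x).trans (by
      have : |x| ≤ |s| := abs_le.2 hx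
      gcongr)) (convex_Icc _ _) (by simp) (by simp [le_abs_self, neg_le, neg_le_abs s])
  rw [h0, sub_zero, sub_zero, Real.norm_eq_abs, Real.norm_eq_abs] at this
  rw [pow_succ]; linarith

lemma IsJet.coord {h h1 h2 h3 : ℝ → ℝ} {K : ℝ} (hK : 0 ≤ K)
    (d0 : ∀ x, HasDerivAt h (h1 x) x) (d1 : ∀ x, HasDerivAt h1 (h2 x) x)
    (d2 : ∀ x, HasDerivAt h2 (h3 x) x)
    (b0 : ∀ x, |h x| ≤ K) (b1 : ∀ x, |h1 x| ≤ K) (b2 : ∀ x, |h2 x| ≤ K) (b3 : ∀ x, |h3 x| ≤ K)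
    [DecidableEq ι] (p : ι) :
    IsJet (fun u => h (u p)) (fun u q => if q = p then h1 (u p) else 0)
      (fun u q r => if q = p then (if r = p then h2 (u p) else 0) else 0) := by
  have hc : Continuous h := continuous_iff_continuousAt.2 fun x => (d0 x).continuousAt
  refine ⟨by fun_prop, K, hK, fun u v => ?_⟩
  have e1 : lin (fun q => if q = p then h1 (u p) else 0) v = h1 (u p) * v p := by simp [lin]
  have e2 : quad (fun q r => if q = p then (if r = p then h2 (u p) else 0) else 0) v
      = h2 (u p) * v p ^ 2 / 2 := by
    simp [quad, ite_mul, Finset.sum_ite_eq']; ring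
  rw [e1, e2]
  have hv : |v p| ≤ ‖v‖ := PiLp.norm_apply_le v p
  have hadd : (u + v) p = u p + v p := rfl
  rw [hadd]
  set x := u p
  have sh : ∀ {g g' : ℝ → ℝ}, (∀ x, HasDerivAt g (g' x) x) → ∀ s, HasDerivAt (fun s => g (x + s)) (g' (x + s)) s :=
    fun hg s => HasDerivAt.comp_const_add x s (hg _)
  have A0 : ∀ s, |h (x + s) - h x| ≤ K * |s| ^ 1 := integ_bound (n := 0) (ρ := fun s => h1 (x + s)) hK
    (by simp) (fun s => (sh d0 s).sub_const _) (fun s => by simpa using b1 _)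
  have A1 : ∀ s, |h1 (x + s) - h1 x| ≤ K * |s| ^ 1 := integ_bound (n := 0) (ρ := fun s => h2 (x + s)) hK
    (by simp) (fun s => (sh d1 s).sub_const _) (fun s => by simpa using b2 _)
  have A2 : ∀ s, |h2 (x + s) - h2 x| ≤ K * |s| ^ 1 := integ_bound (n := 0) (ρ := fun s => h3 (x + s)) hK
    (by simp) (fun s => (sh d2 s).sub_const _) (fun s => by simpa using b3 _)
  have lind : ∀ (c s : ℝ), HasDerivAt (fun s => c * s) c s := fun c s => by
    simpa using (hasDerivAt_id s).const_mul c
  have B0 : ∀ s, |h (x + s) - h x - h1 x * s| ≤ K * |s| ^ 2 :=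
    integ_bound (n := 1) (ρ := fun s => h1 (x + s) - h1 x) hK
    (by simp) (fun s => ((sh d0 s).sub_const _).sub (lind _ _)) A1
  have B1 : ∀ s, |h1 (x + s) - h1 x - h2 x * s| ≤ K * |s| ^ 2 :=
    integ_bound (n := 1) (ρ := fun s => h2 (x + s) - h2 x) hK
    (by simp) (fun s => ((sh d1 s).sub_const _).sub (lind _ _)) A2
  have C0 : ∀ s, |h (x + s) - h x - h1 x * s - h2 x * s ^ 2 / 2| ≤ K * |s| ^ 3 :=
    integ_bound (n := 2) (ρ := fun s => h1 (x + s) - h1 x - h2 x * s) hK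
    (by simp) (fun s => (((sh d0 s).sub_const _).sub (lind _ _)).sub (by
      have := ((hasDerivAt_pow 2 s).const_mul (h2 x)).div_const 2
      exact this.congr_deriv (by norm_num; ring))) B1
  have hn : 0 ≤ |v p| := abs_nonneg _
  refine ⟨b0 _, abs_mul_le' (b1 _) hv, ?_, (A0 _).trans ?_, (B0 _).trans ?_, (C0 _).trans ?_⟩
  · rw [mul_div_assoc]
    refine abs_mul_le' (b2 _) ?_
    rw [abs_div, abs_pow]
    have : |v p| ^ 2 ≤ ‖v‖ ^ 2 := by gcongr
    have h2 : |(2:ℝ)| = 2 := by norm_num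
    rw [h2]
    nlinarith [sq_nonneg |v p|]
  · rw [pow_one]; gcongr
  · gcongr
  · gcongr

end Gordon

namespace Gordon

/-- smooth threshold -/
noncomputable def thr (k t x : ℝ) : ℝ := Real.sigmoid (k ^ 2 * (t - x) + k)

lemma thr_nonneg (k t x : ℝ) : 0 ≤ thr k t x := Real.sigmoid_nonneg _
lemma thr_le_one (k t x : ℝ) : thr k t x ≤ 1 := Real.sigmoid_le_one _

lemma thr_hasDeriv (k t x : ℝ) :
    HasDerivAt (thr k t) (-(k ^ 2) * (thr k t x * (1 - thr k t x))) x := by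
  have h1 : HasDerivAt (fun x => k ^ 2 * (t - x) + k) (-(k ^ 2)) x := by
    have := (((hasDerivAt_id x).const_sub t).const_mul (k ^ 2)).add_const k
    simpa using this
  have := (Real.hasDerivAt_sigmoid (k ^ 2 * (t - x) + k)).comp x h1
  exact this.congr_deriv (by simp only [thr]; ring)

lemma thr_jet {ι : Type*} [Fintype ι] [DecidableEq ι] (k t : ℝ) (p : ι) :
    ∃ h2 : ℝ → ℝ, IsJet (fun u : EuclideanSpace ℝ ι => thr k t (u p))
      (fun u q => if q = p then -(k ^ 2) * (thr k t (u p) * (1 - thr k t (u p))) else 0)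
      (fun u q r => if q = p then (if r = p then h2 (u p) else 0) else 0) := by
  set s := thr k t with hs
  refine ⟨fun x => k ^ 4 * (s x * (1 - s x) * (1 - 2 * s x)),
    IsJet.coord (h := s) (h1 := fun x => -(k ^ 2) * (s x * (1 - s x)))
      (h2 := fun x => k ^ 4 * (s x * (1 - s x) * (1 - 2 * s x)))
      (h3 := fun x => -(k ^ 6) * (s x * (1 - s x) * (1 - 6 * s x + 6 * s x ^ 2)))
      (K := 1 + k ^ 2 + k ^ 4 + k ^ 6) (by positivity)
      (thr_hasDeriv k t) ?_ ?_ ?_ ?_ ?_ ?_ p⟩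
  · intro x
    have hd := thr_hasDeriv k t x
    have := (hd.mul (hd.const_sub 1)).const_mul (-(k ^ 2))
    exact this.congr_deriv (by simp only [← hs]; ring)
  · intro x
    have hd := thr_hasDeriv k t x
    have := ((hd.mul (hd.const_sub 1)).mul ((hd.const_mul 2).const_sub 1)).const_mul (k ^ 4)
    exact this.congr_deriv (by simp only [← hs, Pi.mul_apply]; ring)
  all_goals
    intro x
    have a := thr_nonneg k t x
    have b := thr_le_one k t x
    rw [← hs] at a b
    have k2 : 0 ≤ k ^ 2 := by positivity
    have k4 : 0 ≤ k ^ 4 := by positivity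
    have k6 : 0 ≤ k ^ 6 := by positivity
  · rw [abs_le]; constructor <;> linarith
  · have : |s x * (1 - s x)| ≤ 1 := by rw [abs_le]; constructor <;> nlinarith
    rw [abs_mul, abs_neg, abs_of_nonneg k2]; nlinarith
  · have t1 : |s x * (1 - s x)| ≤ 1 := by rw [abs_le]; constructor <;> nlinarith
    have t2 : |1 - 2 * s x| ≤ 1 := by rw [abs_le]; constructor <;> nlinarith
    have := abs_mul_le' t1 t2
    rw [abs_mul, abs_of_nonneg k4]; nlinarith
  · have t1 : |s x * (1 - s x)| ≤ 1 := by rw [abs_le]; constructor <;> nlinarith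
    have t2 : |1 - 6 * s x + 6 * s x ^ 2| ≤ 1 := by
      rw [abs_le]; constructor <;> nlinarith [sq_nonneg (2 * s x - 1)]
    have := abs_mul_le' t1 t2
    rw [abs_mul, abs_neg, abs_of_nonneg k6]; nlinarith

variable {n m : ℕ}

lemma row_jet (k t : ℝ) (i : Fin n) (s : Finset (Fin m)) :
    ∃ D H, IsJet (fun u : EuclideanSpace ℝ (Fin n × Fin m) => ∏ j ∈ s, thr k t (u (i, j))) D H ∧
      (∀ u p, D u p ≤ 0) ∧ (∀ u p q, p ≠ q → 0 ≤ H u p q) ∧ (∀ u p, p.1 ≠ i → D u p = 0) ∧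
      (∀ u p q, p.1 ≠ i → H u p q = 0) ∧ (∀ u p q, q.1 ≠ i → H u p q = 0) := by
  induction s using Finset.induction_on with
  | empty => exact ⟨_, _, by simpa using IsJet.one, by simp, by simp, by simp, by simp, by simp⟩
  | insert j s hj ih =>
    obtain ⟨D, H, hJ, s1, s2, s3, s4, s5⟩ := ih
    obtain ⟨h2, hT⟩ := thr_jet k t (i, j)
    have hP : ∀ u : EuclideanSpace ℝ (Fin n × Fin m), 0 ≤ ∏ j ∈ s, thr k t (u (i, j)) :=
      fun u => Finset.prod_nonneg fun _ _ => thr_nonneg _ _ _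
    have hD : ∀ x, -(k ^ 2) * (thr k t x * (1 - thr k t x)) ≤ 0 := fun x => by
      have a := thr_nonneg k t x
      have b := thr_le_one k t x
      have : 0 ≤ thr k t x * (1 - thr k t x) := mul_nonneg a (by linarith)
      nlinarith [sq_nonneg k]
    have hne : ∀ p : Fin n × Fin m, p.1 ≠ i → p ≠ (i, j) := fun p hp h => hp (by rw [h])
    refine ⟨_, _, by simpa only [Finset.prod_insert hj] using hT.mul hJ, ?_, ?_, ?_, ?_, ?_⟩
    · intro u p
      have t1 := mul_nonpos_of_nonneg_of_nonpos (thr_nonneg k t (u (i, j))) (s1 u p)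
      have t2 : (∏ j ∈ s, thr k t (u (i, j))) *
        (if p = (i, j) then -(k ^ 2) * (thr k t (u (i, j)) * (1 - thr k t (u (i, j)))) else 0) ≤ 0 := by
        refine mul_nonpos_of_nonneg_of_nonpos (hP u) ?_
        split_ifs
        · exact hD _
        · rfl
      exact add_nonpos t2 t1
    · intro u p q hpq
      have t1 := mul_nonneg (thr_nonneg k t (u (i, j))) (s2 u p q hpq)
      have t0 : (if p = (i, j) then (if q = (i, j) then h2 (u (i, j)) else 0) else 0) = 0 := by
        split_ifs with h h'
        · exact absurd (h.trans h'.symm) hpq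
        · rfl
        · rfl
      have t2 : ∀ p q, 0 ≤ 
        (if p = (i, j) then -(k ^ 2) * (thr k t (u (i, j)) * (1 - thr k t (u (i, j)))) else 0) * D u q := by
        intro p q
        refine mul_nonneg_of_nonpos_of_nonpos ?_ (s1 u q)
        split_ifs
        · exact hD _
        · rfl
      have t3 := t2 p q
      have t4 := t2 q p
      simp only [t0, mul_zero, zero_add]
      rw [mul_comm (D u p)]
      positivity
    · intro u p hp
      simp [hne p hp, s3 u p hp]
    · intro u p q hp
      simp [hne p hp, s3 u p hp, s4 u p q hp]
    · intro u p q hp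
      simp [hne q hp, s3 u q hp, s5 u p q hp]

/-- the test function -/
noncomputable def test (k t : ℝ) (s : Finset (Fin n)) (u : EuclideanSpace ℝ (Fin n × Fin m)) : ℝ :=
  ∏ i ∈ s, (1 - ∏ j, thr k t (u (i, j)))

lemma fac_nonneg (k t : ℝ) (i : Fin n) (u : EuclideanSpace ℝ (Fin n × Fin m)) :
    0 ≤ 1 - ∏ j, thr k t (u (i, j)) := by
  have : ∏ j, thr k t (u (i, j)) ≤ 1 :=
    Finset.prod_le_one (fun _ _ => thr_nonneg _ _ _) (fun _ _ => thr_le_one _ _ _)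
  linarith

lemma test_nonneg (k t : ℝ) (s : Finset (Fin n)) (u : EuclideanSpace ℝ (Fin n × Fin m)) :
    0 ≤ test k t s u := Finset.prod_nonneg fun _ _ => fac_nonneg _ _ _ _

lemma test_le_one (k t : ℝ) (s : Finset (Fin n)) (u : EuclideanSpace ℝ (Fin n × Fin m)) :
    test k t s u ≤ 1 := Finset.prod_le_one (fun _ _ => fac_nonneg _ _ _ _) fun i _ => by
  have : 0 ≤ ∏ j, thr k t (u (i, j)) := Finset.prod_nonneg fun _ _ => thr_nonneg _ _ _
  linarith

lemma test_jet (k t : ℝ) (s : Finset (Fin n)) :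
    ∃ D H, IsJet (test (m := m) k t s) D H ∧
      (∀ u p, 0 ≤ D u p) ∧ (∀ u p, p.1 ∉ s → D u p = 0) ∧
      (∀ u p q, p ≠ q → p.1 = q.1 → H u p q ≤ 0) ∧ (∀ u p q, p.1 ≠ q.1 → 0 ≤ H u p q) := by
  induction s using Finset.induction_on with
  | empty => exact ⟨fun _ _ => 0, fun _ _ _ => 0, by
      have : test (n := n) (m := m) k t ∅ = fun _ => 1 := by funext u; simp [test]
      rw [this]; exact IsJet.one, by simp, by simp, by simp, by simp⟩
  | insert i s hi ih =>
    obtain ⟨D, H, hJ, s1, s2, s3, s4⟩ := ih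
    obtain ⟨D', H', hJ', r1, r2, r3, r4, r5⟩ := row_jet (m := m) k t i Finset.univ
    have e : test (m := m) k t (insert i s) = fun u => test k t s u * (1 - ∏ j, thr k t (u (i, j))) := by
      funext u; rw [test, Finset.prod_insert hi, mul_comm]; rfl
    refine ⟨_, _, by rw [e]; exact hJ.mul hJ'.one_sub, ?_, ?_, ?_, ?_⟩
    · intro u p
      have a := mul_nonneg (fac_nonneg k t i u) (s1 u p)
      have b := mul_nonneg (test_nonneg k t s u) (neg_nonneg.2 (r1 u p))
      exact add_nonneg a b
    · intro u p hp
      rw [Finset.mem_insert, not_or] at hp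
      simp [s2 u p hp.2, r3 u p hp.1]
    · intro u p q hpq hrow
      have a := mul_nonpos_of_nonneg_of_nonpos (fac_nonneg k t i u) (s3 u p q hpq hrow)
      have b := mul_nonpos_of_nonneg_of_nonpos (test_nonneg k t s u) (neg_nonpos.2 (r2 u p q hpq))
      have c : D u p * -D' u q + -D' u p * D u q = 0 := by
        by_cases hp : p.1 = i
        · rw [s2 u p (hp ▸ hi), s2 u q (hrow ▸ hp ▸ hi)]; ring
        · rw [r3 u p hp, r3 u q (hrow ▸ hp)]; ring
      simp only [c, add_zero]
      linarith
    · intro u p q hrow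
      have a := mul_nonneg (fac_nonneg k t i u) (s4 u p q hrow)
      have b : H' u p q = 0 := by
        by_cases hp : p.1 = i
        · exact r5 u p q (fun h => hrow (hp.trans h.symm))
        · exact r4 u p q hp
      have c := mul_nonneg (s1 u p) (neg_nonneg.2 (r1 u q))
      have d := mul_nonneg (neg_nonneg.2 (r1 u p)) (s1 u q)
      simp only [b, neg_zero, mul_zero, add_zero]
      linarith

end Gordon

namespace Gordon

variable {ι : Type*} [Fintype ι]

/-- centered Gaussian law with covariance C -/
structure GLaw (μ : Measure (EuclideanSpace ℝ ι)) (C : ι → ι → ℝ) : Prop where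
  prob : IsProbabilityMeasure μ
  cf : ∀ t, charFun μ t = Complex.exp ((-(quad C t) : ℝ) : ℂ)
  i1 : ∀ p, Integrable (fun x => x p) μ
  m1 : ∀ p, ∫ x, x p ∂μ = 0
  i2 : ∀ p q, Integrable (fun x => x p * x q) μ
  m2 : ∀ p q, ∫ x, x p * x q ∂μ = C p q
  i3 : Integrable (fun x => ‖x‖ ^ 3) μ

lemma expand {f : EuclideanSpace ℝ ι → ℝ} {D H} (hJ : IsJet f D H)
    {μ : Measure (EuclideanSpace ℝ ι)} {C} (hμ : GLaw μ C) :
    ∃ K : ℝ, 0 ≤ K ∧ ∀ u c, 0 ≤ c →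
      |(∫ x, f (u + c • x) ∂μ) - f u - c ^ 2 * ((1 / 2) * ∑ p, ∑ q, H u p q * C p q)| ≤ K * c ^ 3 := by
  obtain ⟨K, hK, h⟩ := hJ.ex
  have := hμ.prob
  refine ⟨K * ∫ x, ‖x‖ ^ 3 ∂μ, mul_nonneg hK (integral_nonneg fun x => by positivity), ?_⟩
  intro u c hc
  have hfc := hJ.cont
  have I0 : Integrable (fun x => f (u + c • x)) μ :=
    Integrable.of_bound (by fun_prop) K (ae_of_all _ fun x => (h (u + c • x) 0).1)
  have e1 : ∀ x, lin (D u) (c • x) = ∑ p, (c * D u p) * x p := fun x => by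
    simp only [lin]
    exact Finset.sum_congr rfl fun p _ => by
      rw [PiLp.smul_apply, smul_eq_mul]; ring
  have e2 : ∀ x, quad (H u) (c • x) = ∑ p, ∑ q, (c ^ 2 / 2 * H u p q) * (x p * x q) := fun x => by
    simp only [quad, Finset.mul_sum]
    exact Finset.sum_congr rfl fun p _ => Finset.sum_congr rfl fun q _ => by
      simp only [PiLp.smul_apply, smul_eq_mul]; ring
  have I1 : Integrable (fun x => lin (D u) (c • x)) μ := by
    simp only [e1]
    exact integrable_finsetSum _ fun p _ => (hμ.i1 p).const_mul _
  have I2 : Integrable (fun x => quad (H u) (c • x)) μ := by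
    simp only [e2]
    exact integrable_finsetSum _ fun p _ => integrable_finsetSum _ fun q _ => (hμ.i2 p q).const_mul _
  have J1 : ∫ x, lin (D u) (c • x) ∂μ = 0 := by
    simp only [e1]
    rw [integral_finsetSum _ fun p _ => (hμ.i1 p).const_mul _]
    simp [integral_const_mul, hμ.m1]
  have J2 : ∫ x, quad (H u) (c • x) ∂μ = c ^ 2 * ((1 / 2) * ∑ p, ∑ q, H u p q * C p q) := by
    simp only [e2]
    rw [integral_finsetSum _ fun p _ => integrable_finsetSum _ fun q _ => (hμ.i2 p q).const_mul _]
    simp only [Finset.mul_sum]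
    refine Finset.sum_congr rfl fun p _ => ?_
    rw [integral_finsetSum _ fun q _ => (hμ.i2 p q).const_mul _]
    refine Finset.sum_congr rfl fun q _ => ?_
    rw [integral_const_mul, hμ.m2]; ring
  have key : ∫ x, (f (u + c • x) - f u - lin (D u) (c • x) - quad (H u) (c • x)) ∂μ
      = (∫ x, f (u + c • x) ∂μ) - f u - c ^ 2 * ((1 / 2) * ∑ p, ∑ q, H u p q * C p q) := by
    have Ia : Integrable (fun x => f (u + c • x) - f u) μ := I0.sub (integrable_const _)
    have Ib : Integrable (fun x => f (u + c • x) - f u - lin (D u) (c • x)) μ := Ia.sub I1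
    rw [integral_sub Ib I2, integral_sub Ia I1, integral_sub I0 (integrable_const _), J1, J2]
    simp
  rw [← key, ← Real.norm_eq_abs]
  refine (norm_integral_le_of_norm_le (g := fun x => (K * c ^ 3) * ‖x‖ ^ 3) (hμ.i3.const_mul _)
    (ae_of_all _ fun x => ?_)).trans (le_of_eq ?_)
  · refine (h u (c • x)).2.2.2.2.2.trans (le_of_eq ?_)
    rw [norm_smul, Real.norm_of_nonneg hc]; ring
  · rw [integral_const_mul]; ring

lemma step {f : EuclideanSpace ℝ ι → ℝ} {D H} (hJ : IsJet f D H)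
    {μ ν : Measure (EuclideanSpace ℝ ι)} {C C'} (hμ : GLaw μ C) (hν : GLaw ν C')
    (hs : ∀ u p q, 0 ≤ (C' p q - C p q) * H u p q) :
    ∃ K : ℝ, 0 ≤ K ∧ ∀ (η : Measure (EuclideanSpace ℝ ι)) [IsProbabilityMeasure η] (c : ℝ), 0 ≤ c →
      ∫ x, f x ∂(η ∗ μ.map (c • ·)) ≤ ∫ x, f x ∂(η ∗ ν.map (c • ·)) + K * c ^ 3 := by
  obtain ⟨K, hK, h⟩ := expand hJ hμ
  obtain ⟨K', hK', h'⟩ := expand hJ hν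
  obtain ⟨B, hB, hb⟩ := hJ.ex
  have := hμ.prob
  have := hν.prob
  have hfc := hJ.cont
  refine ⟨K + K', by positivity, fun η _ c hc => ?_⟩
  have P1 : IsProbabilityMeasure (μ.map (c • ·)) :=
    Measure.isProbabilityMeasure_map (by fun_prop)
  have P2 : IsProbabilityMeasure (ν.map (c • ·)) :=
    Measure.isProbabilityMeasure_map (by fun_prop)
  have bI : ∀ (ρ : Measure (EuclideanSpace ℝ ι)) [IsProbabilityMeasure ρ], Integrable f ρ := fun ρ _ =>
    Integrable.of_bound (by fun_prop) B (ae_of_all _ fun x => (hb x 0).1)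
  have E : ∀ (ρ : Measure (EuclideanSpace ℝ ι)) [IsProbabilityMeasure ρ],
      ∫ x, f x ∂(η ∗ ρ.map (c • ·)) = ∫ u, ∫ x, f (u + c • x) ∂ρ ∂η := by
    intro ρ _
    have : IsProbabilityMeasure (ρ.map (c • ·)) :=
      Measure.isProbabilityMeasure_map (by fun_prop)
    rw [integral_conv (bI _)]
    congr 1; funext u
    rw [integral_map (by fun_prop) (by fun_prop)]
  have I : ∀ (ρ : Measure (EuclideanSpace ℝ ι)) [IsProbabilityMeasure ρ],
      Integrable (fun u => ∫ x, f (u + c • x) ∂ρ) η := by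
    intro ρ _
    refine Integrable.of_bound ?_ B (ae_of_all _ fun u => ?_)
    · have : StronglyMeasurable (fun z : EuclideanSpace ℝ ι × EuclideanSpace ℝ ι => f (z.1 + c • z.2)) :=
        Continuous.stronglyMeasurable (by fun_prop)
      exact this.integral_prod_right.aestronglyMeasurable
    · refine (norm_integral_le_of_norm_le_const (C := B) (ae_of_all _ fun x => (hb _ 0).1)).trans ?_
      simp
  rw [E μ, E ν]
  have : ∫ u, ((∫ x, f (u + c • x) ∂ν) + (K + K') * c ^ 3) ∂η
      = ∫ u, ∫ x, f (u + c • x) ∂ν ∂η + (K + K') * c ^ 3 := by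
    rw [integral_add (I ν) (integrable_const _)]; simp
  rw [← this]
  refine integral_mono (I μ) ((I ν).add (integrable_const _)) fun u => ?_
  have a := (abs_le.1 (h u c hc)).2
  have a' := (abs_le.1 (h' u c hc)).1
  have q : (∑ p, ∑ q, H u p q * C p q) ≤ ∑ p, ∑ q, H u p q * C' p q :=
    Finset.sum_le_sum fun p _ => Finset.sum_le_sum fun q _ => by
      have := hs u p q
      nlinarith
  have q' := mul_le_mul_of_nonneg_left q (show 0 ≤ c ^ 2 * (1 / 2) by positivity)
  simp only
  linarith

lemma quad_smul (C : ι → ι → ℝ) (r : ℝ) (t : EuclideanSpace ℝ ι) :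
    quad C (r • t) = r ^ 2 * quad C t := by
  simp only [quad, Finset.mul_sum]
  exact Finset.sum_congr rfl fun p _ => Finset.sum_congr rfl fun q _ => by
    simp only [PiLp.smul_apply, smul_eq_mul]; ring

lemma compare {f : EuclideanSpace ℝ ι → ℝ} {D H} (hJ : IsJet f D H)
    {μ ν : Measure (EuclideanSpace ℝ ι)} {C C'} (hμ : GLaw μ C) (hν : GLaw ν C')
    (hs : ∀ u p q, 0 ≤ (C' p q - C p q) * H u p q) :
    ∫ x, f x ∂μ ≤ ∫ x, f x ∂ν := by
  obtain ⟨K, hK, hst⟩ := step hJ hμ hν hs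
  have := hμ.prob
  have := hν.prob
  have P : ∀ (ρ : Measure (EuclideanSpace ℝ ι)) [IsProbabilityMeasure ρ] (c : ℝ),
    IsProbabilityMeasure (ρ.map (c • ·)) := fun ρ _ c => Measure.isProbabilityMeasure_map (by fun_prop)
  have P1 := P μ
  have P2 := P ν
  let mix : ℝ → ℝ → Measure (EuclideanSpace ℝ ι) := fun a b =>
    μ.map (√a • ·) ∗ ν.map (√b • ·)
  have Pm : ∀ a b, IsProbabilityMeasure (mix a b) := fun a b => by
    dsimp only [mix]; infer_instance
  have cfμ : ∀ a, 0 ≤ a → ∀ t, charFun (μ.map (√a • ·)) t = Complex.exp ((-(a * quad C t) : ℝ) : ℂ) := by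
    intro a ha t
    rw [charFun_map_smul, hμ.cf, quad_smul, Real.sq_sqrt ha]
  have cfν : ∀ a, 0 ≤ a → ∀ t, charFun (ν.map (√a • ·)) t = Complex.exp ((-(a * quad C' t) : ℝ) : ℂ) := by
    intro a ha t
    rw [charFun_map_smul, hν.cf, quad_smul, Real.sq_sqrt ha]
  have cfm : ∀ a b, 0 ≤ a → 0 ≤ b → ∀ t, charFun (mix a b) t =
      Complex.exp ((-(a * quad C t + b * quad C' t) : ℝ) : ℂ) := by
    intro a b ha hb t
    simp only [mix]
    rw [charFun_conv, cfμ a ha, cfν b hb, ← Complex.exp_add]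
    congr 1; push_cast; ring
  have M1 : ∀ a b c, 0 ≤ a → 0 ≤ b → 0 ≤ c → mix a b ∗ μ.map (√c • ·) = mix (a + c) b := by
    intro a b c ha hb hc
    apply Measure.ext_of_charFun
    funext t
    rw [charFun_conv, cfm a b ha hb, cfμ c hc, cfm _ b (by positivity) hb, ← Complex.exp_add]
    congr 1; push_cast; ring
  have M2 : ∀ a b c, 0 ≤ a → 0 ≤ b → 0 ≤ c → mix a b ∗ ν.map (√c • ·) = mix a (b + c) := by
    intro a b c ha hb hc
    apply Measure.ext_of_charFun
    funext t
    rw [charFun_conv, cfm a b ha hb, cfν c hc, cfm a _ ha (by positivity), ← Complex.exp_add]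
    congr 1; push_cast; ring
  have Z1 : mix 1 0 = μ := by
    apply Measure.ext_of_charFun
    funext t
    rw [cfm 1 0 (by norm_num) le_rfl, hμ.cf]; simp
  have Z2 : mix 0 1 = ν := by
    apply Measure.ext_of_charFun
    funext t
    rw [cfm 0 1 le_rfl (by norm_num), hν.cf]; simp
  have fin : ∀ N : ℕ, ∫ x, f x ∂μ ≤ ∫ x, f x ∂ν + K * √(1 / ((N : ℝ) + 1)) := by
    intro N
    set δ : ℝ := 1 / ((N : ℝ) + 1) with hδ
    have hδ0 : 0 ≤ δ := by positivity
    have hδ1 : ((N + 1 : ℕ) : ℝ) * δ = 1 := by rw [hδ]; push_cast; field_simp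
    have ind : ∀ k : ℕ, k ≤ N + 1 → ∫ x, f x ∂μ ≤
        ∫ x, f x ∂(mix (1 - k * δ) (k * δ)) + k * (K * √δ ^ 3) := by
      intro k
      induction k with
      | zero => intro _; simp [Z1]
      | succ k ih =>
        intro hk
        have i := ih (by omega)
        have hk' : ((k + 1 : ℕ) : ℝ) * δ ≤ 1 := by
          rw [← hδ1]; gcongr
        push_cast at hk' ⊢
        have hkδ : 0 ≤ k * δ := by positivity
        have s := hst (mix (1 - (k + 1) * δ) (k * δ)) (√δ) (Real.sqrt_nonneg _)
        rw [M1 _ _ _ (by linarith) hkδ hδ0, M2 _ _ _ (by linarith) hkδ hδ0] at s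
        rw [show 1 - ((k : ℝ) + 1) * δ + δ = 1 - k * δ by ring,
          show (k : ℝ) * δ + δ = (k + 1) * δ by ring] at s
        linarith
    have l := ind (N + 1) le_rfl
    rw [hδ1, sub_self, Z2] at l
    have e : ((N + 1 : ℕ) : ℝ) * (K * √δ ^ 3) = K * √δ := by
      have : √δ ^ 3 = δ * √δ := by rw [pow_succ, Real.sq_sqrt hδ0]
      rw [this]
      linear_combination (K * √δ) * hδ1
    rw [e] at l
    exact l
  have lim : Tendsto (fun N : ℕ => ∫ x, f x ∂ν + K * √(1 / ((N : ℝ) + 1))) atTop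
      (𝓝 (∫ x, f x ∂ν + K * √0)) :=
    ((Real.continuous_sqrt.tendsto _).comp tendsto_one_div_add_atTop_nhds_zero_nat).const_mul K
      |>.const_add _
  rw [Real.sqrt_zero, mul_zero, add_zero] at lim
  exact ge_of_tendsto' lim fin

end Gordon

namespace Gordon

lemma glaw_of {Ω ι : Type*} [MeasureSpace Ω] [IsProbabilityMeasure (volume : Measure Ω)] [Fintype ι]
    (X : ι → Ω → ℝ) (hm : ∀ p, Measurable (X p)) (hX : IsCenteredGaussianFamily X) :
    GLaw (Measure.map (fun ω => WithLp.toLp 2 (fun p => X p ω)) (volume : Measure Ω))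
      (fun p q => ∫ ω, X p ω * X q ω) := by
  classical
  set φ : Ω → EuclideanSpace ℝ ι := fun ω => WithLp.toLp 2 (fun p => X p ω) with hφ
  have hφm : Measurable φ := by
    have : Measurable (fun ω => (fun p => X p ω)) := measurable_pi_lambda _ hm
    exact (WithLp.measurable_toLp 2 (ι → ℝ)).comp this
  have gm : ∀ p, ∃ v : NNReal, Measure.map (X p) (volume : Measure Ω) = gaussianReal 0 v := by
    intro p
    obtain ⟨v, hv⟩ := hX (Pi.single p 1)
    refine ⟨v, ?_⟩
    rw [← hv]
    congr 1
    funext ω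
    simp [Pi.single_apply]
  have mem : ∀ p (r : NNReal), MemLp (X p) r (volume : Measure Ω) := by
    intro p r
    obtain ⟨v, hv⟩ := gm p
    have := memLp_id_gaussianReal (μ := 0) (v := v) r
    rw [← hv] at this
    exact (memLp_map_measure_iff (by fun_prop) (hm p).aemeasurable).1 this
  have int2 : ∀ p q, Integrable (fun ω => X p ω * X q ω) (volume : Measure Ω) := fun p q =>
    MemLp.integrable_mul (p := 2) (q := 2) (mem p 2) (mem q 2)
  have int1 : ∀ p, Integrable (X p) (volume : Measure Ω) := fun p =>
    memLp_one_iff_integrable.1 (mem p 1)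
  refine ⟨Measure.isProbabilityMeasure_map hφm.aemeasurable, ?_, ?_, ?_, ?_, ?_, ?_⟩
  · intro t
    obtain ⟨v, hv⟩ := hX (fun p => t p)
    set S : Ω → ℝ := fun ω => ∑ p, t p * X p ω with hS
    have hSm : Measurable S := by fun_prop
    have e1 : charFun (Measure.map φ (volume : Measure Ω)) t
        = charFun (Measure.map S (volume : Measure Ω)) 1 := by
      rw [charFun_apply, charFun_apply_real, integral_map hφm.aemeasurable (by fun_prop),
        integral_map hSm.aemeasurable (by fun_prop)]
      congr 1; funext ω
      congr 2
      simp [hφ, hS, PiLp.inner_apply]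
    have e2 : (v : ℝ) = ∫ ω, S ω ^ 2 := by
      have a : Var[fun x ↦ x; gaussianReal 0 v] = v := variance_fun_id_gaussianReal
      rw [variance_of_integral_eq_zero (by fun_prop) (by simp)] at a
      rw [← a, ← hv, integral_map hSm.aemeasurable (by fun_prop)]
    have e3 : ∫ ω, S ω ^ 2 = ∑ p, ∑ q, (t p * t q) * ∫ ω, X p ω * X q ω := by
      have : ∀ ω, S ω ^ 2 = ∑ p, ∑ q, (t p * t q) * (X p ω * X q ω) := fun ω => by
        rw [sq, hS, Finset.sum_mul_sum]
        exact Finset.sum_congr rfl fun p _ => Finset.sum_congr rfl fun q _ => by ring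
      simp only [this]
      rw [integral_finsetSum _ fun p _ => integrable_finsetSum _ fun q _ => (int2 p q).const_mul _]
      refine Finset.sum_congr rfl fun p _ => ?_
      rw [integral_finsetSum _ fun q _ => (int2 p q).const_mul _]
      exact Finset.sum_congr rfl fun q _ => integral_const_mul _ _
    have e4 : (v : ℝ) / 2 = quad (fun p q => ∫ ω, X p ω * X q ω) t := by
      rw [e2, e3, quad, div_eq_mul_one_div, mul_comm]
      congr 1
      exact Finset.sum_congr rfl fun p _ => Finset.sum_congr rfl fun q _ => by ring
    rw [e1, hv, charFun_gaussianReal, ← e4]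
    congr 1
    push_cast; simp
  · intro p
    rw [integrable_map_measure (by fun_prop) hφm.aemeasurable]
    exact int1 p
  · intro p
    rw [integral_map hφm.aemeasurable (by fun_prop)]
    obtain ⟨v, hv⟩ := gm p
    have : ∫ x, x ∂(gaussianReal 0 v) = 0 := integral_id_gaussianReal
    rw [← hv, integral_map (hm p).aemeasurable (by fun_prop)] at this
    exact this
  · intro p q
    rw [integrable_map_measure (by fun_prop) hφm.aemeasurable]
    exact int2 p q
  · intro p q
    rw [integral_map hφm.aemeasurable (by fun_prop)]
  · rw [integrable_map_measure (by fun_prop) hφm.aemeasurable]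
    have h3 : MemLp (fun ω => ∑ p, |X p ω|) 3 (volume : Measure Ω) :=
      memLp_finsetSum _ fun p _ => (mem p 3).abs
    have : MemLp φ 3 (volume : Measure Ω) := by
      refine h3.mono hφm.aestronglyMeasurable (ae_of_all _ fun ω => ?_)
      rw [Real.norm_of_nonneg (Finset.sum_nonneg fun p _ => abs_nonneg _), EuclideanSpace.norm_eq]
      refine Real.sqrt_le_iff.2 ⟨Finset.sum_nonneg fun p _ => abs_nonneg _, ?_⟩
      exact Finset.sum_sq_le_sq_sum_of_nonneg fun p _ => abs_nonneg _
    exact this.integrable_norm_pow (p := 3) (by norm_num)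

lemma thr_tendsto (t x : ℝ) :
    Tendsto (fun k : ℕ => thr (k : ℝ) t x) atTop (𝓝 (if x ≤ t then 1 else 0)) := by
  have hk : Tendsto (fun k : ℕ => (k : ℝ)) atTop atTop := tendsto_natCast_atTop_atTop
  split_ifs with h
  · refine Real.tendsto_sigmoid_atTop.comp (tendsto_atTop_mono (fun k => ?_) hk)
    have : 0 ≤ (k : ℝ) ^ 2 * (t - x) := mul_nonneg (by positivity) (by linarith)
    linarith
  · refine Real.tendsto_sigmoid_atBot.comp ?_
    have h1 : Tendsto (fun k : ℕ => (k : ℝ) * (t - x) + 1) atTop atBot :=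
      tendsto_atBot_add_const_right _ _ (hk.atTop_mul_const_of_neg (by linarith))
    have := hk.atTop_mul_atBot₀ h1
    refine this.congr fun k => by ring

open Classical in
lemma test_tendsto {n m : ℕ} (t : ℝ) (u : EuclideanSpace ℝ (Fin n × Fin m)) :
    Tendsto (fun k : ℕ => test (k : ℝ) t Finset.univ u) atTop
      (𝓝 ({u : EuclideanSpace ℝ (Fin n × Fin m) | ∀ i, ∃ j, t < u (i, j)}.indicator (fun _ => 1) u)) := by
  have h : Tendsto (fun k : ℕ => test (k : ℝ) t Finset.univ u) atTop
      (𝓝 (∏ i, (1 - ∏ j, (if u (i, j) ≤ t then (1 : ℝ) else 0)))) :=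
    tendsto_finsetProd _ fun i _ => (tendsto_finsetProd _ fun j _ => thr_tendsto t _).const_sub 1
  convert h using 2
  have e : ∀ i, (1 : ℝ) - ∏ j, (if u (i, j) ≤ t then (1 : ℝ) else 0) =
      if ∃ j, t < u (i, j) then 1 else 0 := by
    intro i
    rw [Finset.prod_ite_zero]
    by_cases hh : ∃ j, t < u (i, j)
    · have : ¬ ∀ j ∈ Finset.univ, u (i, j) ≤ t := by
        obtain ⟨j, hj⟩ := hh
        exact fun H => absurd (H j (Finset.mem_univ _)) (not_le.2 hj)
      rw [if_neg this, if_pos hh]; simp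
    · have : ∀ j ∈ Finset.univ, u (i, j) ≤ t := fun j _ => not_lt.1 fun h => hh ⟨j, h⟩
      rw [if_pos this, if_neg hh]; simp
  rw [Finset.prod_congr rfl fun i _ => e i]
  simp only [Finset.prod_ite_zero, Set.indicator, Set.mem_ofPred_eq]
  simp

variable {Ω : Type*} [MeasureSpace Ω] [IsProbabilityMeasure (volume : Measure Ω)]

/-- upper orthant-type comparison -/
lemma meas_Ioi (n m : ℕ)
    (X Y : Fin n → Fin m → Ω → ℝ)
    (hXmeas : ∀ i j, Measurable (X i j)) (hYmeas : ∀ i j, Measurable (Y i j))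
    (hXgauss : IsCenteredGaussianFamily (fun p : Fin n × Fin m => X p.1 p.2))
    (hYgauss : IsCenteredGaussianFamily (fun p : Fin n × Fin m => Y p.1 p.2))
    (h1 : ∀ i j, ∫ ω, X i j ω * X i j ω = ∫ ω, Y i j ω * Y i j ω)
    (h2 : ∀ i j k, ∫ ω, Y i j ω * Y i k ω ≤ ∫ ω, X i j ω * X i k ω)
    (h3 : ∀ i l j k, i ≠ l → ∫ ω, X i j ω * X l k ω ≤ ∫ ω, Y i j ω * Y l k ω) (t : ℝ) :
    (volume : Measure Ω) {ω | ∀ i, ∃ j, t < X i j ω} ≤ (volume : Measure Ω) {ω | ∀ i, ∃ j, t < Y i j ω} := by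
  have gX := glaw_of (fun p : Fin n × Fin m => X p.1 p.2) (fun p => hXmeas p.1 p.2) hXgauss
  have gY := glaw_of (fun p : Fin n × Fin m => Y p.1 p.2) (fun p => hYmeas p.1 p.2) hYgauss
  have cmp : ∀ k : ℕ,
      ∫ u, test (n := n) (m := m) (k : ℝ) t Finset.univ u
        ∂(Measure.map (fun ω => (WithLp.toLp 2 (fun p : Fin n × Fin m => X p.1 p.2 ω) :
          EuclideanSpace ℝ (Fin n × Fin m))) (volume : Measure Ω))
      ≤ ∫ u, test (n := n) (m := m) (k : ℝ) t Finset.univ u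
        ∂(Measure.map (fun ω => (WithLp.toLp 2 (fun p : Fin n × Fin m => Y p.1 p.2 ω) :
          EuclideanSpace ℝ (Fin n × Fin m))) (volume : Measure Ω)) := fun k => by
    obtain ⟨D, H, hJ, -, -, s3, s4⟩ := test_jet (n := n) (m := m) (k : ℝ) t Finset.univ
    refine compare hJ gX gY ?_
    rintro u ⟨i, j⟩ ⟨l, q⟩
    by_cases hil : i = l
    · subst hil
      by_cases hjq : j = q
      · subst hjq
        simp [h1]
      · exact mul_nonneg_of_nonpos_of_nonpos (sub_nonpos.2 (h2 i j q))
          (s3 u _ _ (by simp [hjq]) rfl)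
    · exact mul_nonneg (sub_nonneg.2 (h3 i l j q hil)) (s4 u _ _ hil)
  set A : Set (EuclideanSpace ℝ (Fin n × Fin m)) := {u | ∀ i, ∃ j, t < u (i, j)} with hA
  have hAm : MeasurableSet A := by
    have : A = ⋂ i, ⋃ j, {u : EuclideanSpace ℝ (Fin n × Fin m) | t < u (i, j)} := by
      ext u; simp [hA]
    rw [this]
    exact MeasurableSet.iInter fun i => MeasurableSet.iUnion fun j =>
      measurableSet_lt measurable_const (by fun_prop)
  have lim : ∀ (μ : Measure (EuclideanSpace ℝ (Fin n × Fin m))) [IsProbabilityMeasure μ],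
      Tendsto (fun k : ℕ => ∫ u, test (k : ℝ) t Finset.univ u ∂μ) atTop (𝓝 (μ.real A)) := by
    intro μ _
    have e : μ.real A = ∫ u, A.indicator (fun _ => (1 : ℝ)) u ∂μ := by
      rw [integral_indicator hAm]; simp
    rw [e]
    refine tendsto_integral_of_dominated_convergence (fun _ => 1) (fun k => ?_) (integrable_const _)
      (fun k => ae_of_all _ fun u => ?_) (ae_of_all _ fun u => test_tendsto t u)
    · obtain ⟨D, H, hJ, -⟩ := test_jet (n := n) (m := m) (k : ℝ) t Finset.univ
      exact hJ.cont.aestronglyMeasurable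
    · rw [Real.norm_of_nonneg (test_nonneg _ _ _ _)]; exact test_le_one _ _ _ _
  have := gX.prob
  have := gY.prob
  have fin := le_of_tendsto_of_tendsto' (lim _) (lim _) cmp
  have mm : ∀ Z : Fin n → Fin m → Ω → ℝ, (∀ i j, Measurable (Z i j)) →
      Measurable (fun ω => (WithLp.toLp 2 (fun p : Fin n × Fin m => Z p.1 p.2 ω) :
        EuclideanSpace ℝ (Fin n × Fin m))) := fun Z hZ =>
    (WithLp.measurable_toLp 2 (Fin n × Fin m → ℝ)).comp (measurable_pi_lambda _ fun p => hZ p.1 p.2)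
  rw [map_measureReal_apply (mm X hXmeas) hAm, map_measureReal_apply (mm Y hYmeas) hAm] at fin
  exact (ENNReal.toReal_le_toReal (measure_ne_top _ _) (measure_ne_top _ _)).1 fin

lemma meas_Ici {n m : ℕ} (X Y : Fin n → Fin m → Ω → ℝ)
    (hXmeas : ∀ i j, Measurable (X i j)) (hYmeas : ∀ i j, Measurable (Y i j))
    (h : ∀ t : ℝ, (volume : Measure Ω) {ω | ∀ i, ∃ j, t < X i j ω} ≤ (volume : Measure Ω) {ω | ∀ i, ∃ j, t < Y i j ω})
    (t : ℝ) :
    (volume : Measure Ω) {ω | ∀ i, ∃ j, t ≤ X i j ω} ≤ (volume : Measure Ω) {ω | ∀ i, ∃ j, t ≤ Y i j ω} := by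
  have key : ∀ Z : Fin n → Fin m → Ω → ℝ, (∀ i j, Measurable (Z i j)) →
      Tendsto (fun k : ℕ => (volume : Measure Ω) {ω | ∀ i, ∃ j, t - 1 / ((k : ℝ) + 1) < Z i j ω}) atTop
        (𝓝 ((volume : Measure Ω) {ω | ∀ i, ∃ j, t ≤ Z i j ω})) := by
    intro Z hZ
    have e : {ω | ∀ i, ∃ j, t ≤ Z i j ω} = ⋂ k : ℕ, {ω | ∀ i, ∃ j, t - 1 / ((k : ℝ) + 1) < Z i j ω} := by
      ext ω
      simp only [Set.mem_ofPred_eq, Set.mem_iInter]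
      constructor
      · intro H k i
        obtain ⟨j, hj⟩ := H i
        have : 0 < 1 / ((k : ℝ) + 1) := by positivity
        exact ⟨j, by linarith⟩
      · intro H i
        by_contra hc
        push Not at hc
        have ev : ∀ j, ∀ᶠ k : ℕ in atTop, Z i j ω < t - 1 / ((k : ℝ) + 1) := by
          intro j
          have : Tendsto (fun k : ℕ => t - 1 / ((k : ℝ) + 1)) atTop (𝓝 (t - 0)) :=
            tendsto_one_div_add_atTop_nhds_zero_nat.const_sub t
          rw [sub_zero] at this
          exact this.eventually_const_lt (hc j)
        obtain ⟨k, hk⟩ := (eventually_all.2 ev).exists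
        obtain ⟨j, hj⟩ := H k i
        exact absurd (hk j) (not_lt.2 hj.le)
    rw [e]
    refine tendsto_measure_iInter_atTop (fun k => MeasurableSet.nullMeasurableSet ?_) ?_
      ⟨0, measure_ne_top _ _⟩
    · have : {ω | ∀ i, ∃ j, t - 1 / ((k : ℝ) + 1) < Z i j ω}
        = ⋂ i, ⋃ j, {ω | t - 1 / ((k : ℝ) + 1) < Z i j ω} := by ext; simp
      rw [this]
      exact MeasurableSet.iInter fun i => MeasurableSet.iUnion fun j =>
        measurableSet_lt measurable_const (hZ i j)
    · intro k l hkl ω H i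
      obtain ⟨j, hj⟩ := H i
      refine ⟨j, lt_of_le_of_lt ?_ hj⟩
      have : 1 / ((l : ℝ) + 1) ≤ 1 / ((k : ℝ) + 1) := by gcongr
      linarith
  exact le_of_tendsto_of_tendsto' (key X hXmeas) (key Y hYmeas) fun k => h _

lemma meas_upper {n m : ℕ} (X Y : Fin n → Fin m → Ω → ℝ)
    (hXmeas : ∀ i j, Measurable (X i j)) (hYmeas : ∀ i j, Measurable (Y i j)) (hm : 0 < m)
    (h : ∀ t : ℝ, (volume : Measure Ω) {ω | ∀ i, ∃ j, t < X i j ω} ≤ (volume : Measure Ω) {ω | ∀ i, ∃ j, t < Y i j ω})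
    {U : Set ℝ} (hU : IsUpperSet U) :
    (volume : Measure Ω) {ω | ∀ i, ∃ j, X i j ω ∈ U} ≤ (volume : Measure Ω) {ω | ∀ i, ∃ j, Y i j ω ∈ U} := by
  rcases U.eq_empty_or_nonempty with rfl | hne
  · simp
  by_cases hb : BddBelow U
  · by_cases ha : sInf U ∈ U
    · have : U = Set.Ici (sInf U) := by
        ext x; exact ⟨fun hx => csInf_le hb hx, fun hx => hU hx ha⟩
      rw [this]
      exact meas_Ici X Y hXmeas hYmeas h _
    · have : U = Set.Ioi (sInf U) := by
        ext x
        refine ⟨fun hx => lt_of_le_of_ne (csInf_le hb hx) fun e => ha (e ▸ hx), fun hx => ?_⟩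
        obtain ⟨y, hy, hyx⟩ := exists_lt_of_csInf_lt hne hx
        exact hU hyx.le hy
      rw [this]
      exact h _
  · have : U = Set.univ := by
      ext x
      simp only [Set.mem_univ, iff_true]
      rw [not_bddBelow_iff] at hb
      obtain ⟨y, hy, hyx⟩ := hb x
      exact hU hyx.le hy
    have nm : Nonempty (Fin m) := ⟨⟨0, hm⟩⟩
    simp [this]

end Gordon

/-- Gordon's Gaussian comparison theorem (min-max form, nondecreasing `ψ`). -/
theorem gordon_min_max_nondecreasing
    {Ω : Type*} [MeasureSpace Ω] [IsProbabilityMeasure (volume : Measure Ω)]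
    (n m : ℕ) (hn : 0 < n) (hm : 0 < m)
    (X Y : Fin n → Fin m → Ω → ℝ)
    (hXmeas : ∀ i j, Measurable (X i j)) (hYmeas : ∀ i j, Measurable (Y i j))
    (hXgauss : IsCenteredGaussianFamily (fun p : Fin n × Fin m => X p.1 p.2))
    (hYgauss : IsCenteredGaussianFamily (fun p : Fin n × Fin m => Y p.1 p.2))
    (h1 : ∀ i j, ∫ ω, X i j ω * X i j ω = ∫ ω, Y i j ω * Y i j ω)
    (h2 : ∀ i j k, ∫ ω, Y i j ω * Y i k ω ≤ ∫ ω, X i j ω * X i k ω)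
    (h3 : ∀ i l j k, i ≠ l → ∫ ω, X i j ω * X l k ω ≤ ∫ ω, Y i j ω * Y l k ω)
    (ψ : ℝ → ℝ) (hψ : Monotone ψ)
    (hintX : Integrable (fun ω => ⨅ i, ⨆ j, ψ (X i j ω)))
    (hintY : Integrable (fun ω => ⨅ i, ⨆ j, ψ (Y i j ω))) :
    ∫ ω, ⨅ i, ⨆ j, ψ (X i j ω) ≤ ∫ ω, ⨅ i, ⨆ j, ψ (Y i j ω) := by
  have nn : Nonempty (Fin n) := ⟨⟨0, hn⟩⟩
  have nm : Nonempty (Fin m) := ⟨⟨0, hm⟩⟩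
  have hI := Gordon.meas_Ioi n m X Y hXmeas hYmeas hXgauss hYgauss h1 h2 h3
  have up := fun (U : Set ℝ) (hU : IsUpperSet U) => Gordon.meas_upper X Y hXmeas hYmeas hm hI hU
  have elt : ∀ (a : Fin n → Fin m → ℝ) (s : ℝ), s < (⨅ i, ⨆ j, a i j) ↔ ∀ i, ∃ j, s < a i j := by
    intro a s
    constructor
    · intro H i
      exact exists_lt_of_lt_ciSup (H.trans_le (ciInf_le (Set.finite_range _).bddBelow i))
    · intro H
      obtain ⟨i, hi⟩ := exists_eq_ciInf_of_finite (f := fun i => ⨆ j, a i j)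
      rw [← hi]
      obtain ⟨j, hj⟩ := H i
      exact hj.trans_le (le_ciSup (f := fun j => a i j) (Set.finite_range _).bddAbove j)
  have ele : ∀ (a : Fin n → Fin m → ℝ) (s : ℝ), s ≤ (⨅ i, ⨆ j, a i j) ↔ ∀ i, ∃ j, s ≤ a i j := by
    intro a s
    constructor
    · intro H i
      obtain ⟨j, hj⟩ := exists_eq_ciSup_of_finite (f := fun j => a i j)
      exact ⟨j, hj ▸ H.trans (ciInf_le (Set.finite_range fun i => ⨆ j, a i j).bddBelow i)⟩
    · intro H
      refine le_ciInf fun i => ?_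
      obtain ⟨j, hj⟩ := H i
      exact hj.trans (le_ciSup (f := fun j => a i j) (Set.finite_range _).bddAbove j)
  set F := fun ω => ⨅ i, ⨆ j, ψ (X i j ω) with hF
  set G := fun ω => ⨅ i, ⨆ j, ψ (Y i j ω) with hG
  have lt1 : ∀ s : ℝ, (volume : Measure Ω) {ω | s < F ω} ≤ (volume : Measure Ω) {ω | s < G ω} := by
    intro s
    simp only [hF, hG, elt]
    exact up {x | s < ψ x} fun a b hab ha => lt_of_lt_of_le ha (hψ hab)
  have le1 : ∀ s : ℝ, (volume : Measure Ω) {ω | s ≤ F ω} ≤ (volume : Measure Ω) {ω | s ≤ G ω} := by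
    intro s
    simp only [hF, hG, ele]
    exact up {x | s ≤ ψ x} fun a b hab ha => le_trans ha (hψ hab)
  have lt2 : ∀ s : ℝ, (volume : Measure Ω) {ω | G ω < s} ≤ (volume : Measure Ω) {ω | F ω < s} := by
    intro s
    have eF : {ω | F ω < s} = {ω | s ≤ F ω}ᶜ := by ext; simp
    have eG : {ω | G ω < s} = {ω | s ≤ G ω}ᶜ := by ext; simp
    rw [eF, eG, prob_compl_eq_one_sub₀ (nullMeasurableSet_le aemeasurable_const hintX.aemeasurable),
      prob_compl_eq_one_sub₀ (nullMeasurableSet_le aemeasurable_const hintY.aemeasurable)]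
    exact tsub_le_tsub_left (le1 s) 1
  have lc : ∀ A : Ω → ℝ, AEMeasurable A → ∫⁻ ω, ENNReal.ofReal (A ω) =
      ∫⁻ t in Set.Ioi (0 : ℝ), (volume : Measure Ω) {ω | t < A ω} := by
    intro A hA
    have := lintegral_eq_lintegral_meas_lt (volume : Measure Ω) (f := fun ω => max (A ω) 0)
      (ae_of_all _ fun ω => le_max_right _ _) (hA.max aemeasurable_const)
    have e : ∀ ω, ENNReal.ofReal (max (A ω) 0) = ENNReal.ofReal (A ω) := fun ω => by
      simp
    simp only [e] at this
    rw [this]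
    refine setLIntegral_congr_fun measurableSet_Ioi fun t ht => ?_
    congr 1
    ext ω
    have : ¬ t < 0 := not_lt.2 (le_of_lt ht)
    simp [this]
  rw [integral_eq_lintegral_pos_part_sub_lintegral_neg_part hintX,
    integral_eq_lintegral_pos_part_sub_lintegral_neg_part hintY]
  refine sub_le_sub (ENNReal.toReal_mono ?_ ?_) (ENNReal.toReal_mono ?_ ?_)
  · exact ((lintegral_ofReal_le_lintegral_enorm G).trans_lt hintY.2).ne
  · rw [lc F hintX.aemeasurable, lc G hintY.aemeasurable]
    exact lintegral_mono fun t => lt1 t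
  · exact ((lintegral_ofReal_le_lintegral_enorm (fun ω => - F ω)).trans_lt hintX.neg.2).ne
  · rw [lc (fun ω => - F ω) hintX.neg.aemeasurable, lc (fun ω => - G ω) hintY.neg.aemeasurable]
    refine lintegral_mono fun t => ?_
    have := lt2 (-t)
    simpa only [lt_neg] using this
end

section
/- Let n, m be positive integers and let (X_{ij}) and (Y_{ij}), 1 ≤ i ≤ n, 1 ≤ j ≤ m, be two centered jointly Gaussian families of real random variables which satisfy, for all choices of indices: (1) E[X_{ij}²] = E[Y_{ij}²]; (2) E[X_{ij}X_{ik}] ≥ E[Y_{ij}Y_{ik}]; (3) E[X_{ij}X_{lk}] ≤ E[Y_{ij}Y_{lk}] whenever i ≠ l. Then for every nonincreasing function ψ : ℝ → ℝ (for which all the expectations below exist), E[max_{1≤i≤n} min_{1≤j≤m} ψ(X_{ij})] ≥ E[max_{1≤i≤n} min_{1≤j≤m} ψ(Y_{ij})]. -/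
open MeasureTheory ProbabilityTheory

theorem gmm_mvt {E F : Type*} [NormedAddCommGroup E] [NormedSpace ℝ E] [NormedAddCommGroup F]
    [NormedSpace ℝ F] {g : E → F} (hg : ContDiff ℝ 1 g) {C : ℝ}
    (hC : ∀ x, ‖iteratedFDeriv ℝ 1 g x‖ ≤ C) (x w : E) : ‖g x - g w‖ ≤ C * ‖x - w‖ :=
  convex_univ.norm_image_sub_le_of_norm_fderiv_le (𝕜 := ℝ)
    (fun z _ => (hg.differentiable (by norm_num)) z)
    (fun z _ => by rw [← norm_iteratedFDeriv_one]; exact hC z) (Set.mem_univ _)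
    (Set.mem_univ _)

theorem gmm_taylor {E : Type*} [NormedAddCommGroup E] [NormedSpace ℝ E] {f : E → ℝ}
    (hf : ContDiff ℝ 3 f) {C : ℝ} (hC : ∀ x, ‖iteratedFDeriv ℝ 3 f x‖ ≤ C) (w y : E) :
    |f (w + y) - f w - fderiv ℝ f w y - (1/2) * fderiv ℝ (fderiv ℝ f) w y y| ≤ C * ‖y‖^3 := by
  have hC0 : 0 ≤ C := (norm_nonneg _).trans (hC 0)
  have h1 : ContDiff ℝ 2 (fderiv ℝ f) := hf.fderiv_right (by norm_num)
  have h2 : ContDiff ℝ 1 (fderiv ℝ (fderiv ℝ f)) := h1.fderiv_right (by norm_num)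
  have m1 : ∀ x, ‖fderiv ℝ (fderiv ℝ f) x - fderiv ℝ (fderiv ℝ f) w‖ ≤ C * ‖x - w‖ := fun x =>
    gmm_mvt h2 (fun x => by
      rw [norm_iteratedFDeriv_fderiv, norm_iteratedFDeriv_fderiv]
      exact hC x) x w
  have m2 : ∀ x ∈ Metric.closedBall w ‖y‖,
      ‖fderiv ℝ f x - fderiv ℝ f w - fderiv ℝ (fderiv ℝ f) w (x - w)‖ ≤ C * ‖y‖ * ‖x - w‖ := by
    intro x hx
    have hg : ∀ z, HasFDerivAt (fun z => fderiv ℝ f z - fderiv ℝ (fderiv ℝ f) w (z - w))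
        (fderiv ℝ (fderiv ℝ f) z - fderiv ℝ (fderiv ℝ f) w) z := by
      intro z
      refine HasFDerivAt.sub ((h1.differentiable (by norm_num)) z).hasFDerivAt ?_
      have := (fderiv ℝ (fderiv ℝ f) w).hasFDerivAt.comp z ((hasFDerivAt_id z).sub_const w)
      exact this
    have := (convex_closedBall w ‖y‖).norm_image_sub_le_of_norm_hasFDerivWithin_le (𝕜 := ℝ)
      (C := C * ‖y‖)
      (fun z _ => (hg z).hasFDerivWithinAt) (fun z hz => (m1 z).trans
        (mul_le_mul_of_nonneg_left (by simpa [dist_eq_norm] using hz) hC0))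
      (Metric.mem_closedBall_self (norm_nonneg _)) hx
    simp only [sub_self, map_zero, sub_zero] at this
    rwa [sub_right_comm] at this
  have hk : ∀ s : ℝ, HasDerivAt (fun s : ℝ => f (w + s • y) - s * fderiv ℝ f w y
      - s^2 * ((1/2) * fderiv ℝ (fderiv ℝ f) w y y))
      (fderiv ℝ f (w + s • y) y - fderiv ℝ f w y - s * fderiv ℝ (fderiv ℝ f) w y y) s := by
    intro s
    have e1 : HasDerivAt (fun s : ℝ => w + s • y) y s := by
      simpa using ((hasDerivAt_id s).smul_const y).const_add w
    have e2 := ((hf.differentiable (by norm_num)) (w + s • y)).hasFDerivAt.comp_hasDerivAt s e1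
    have e3 := (hasDerivAt_id s).mul_const (fderiv ℝ f w y)
    have e4 := ((hasDerivAt_id s).pow 2).mul_const ((1/2) * fderiv ℝ (fderiv ℝ f) w y y)
    have e5 := (e2.sub e3).sub e4
    refine HasDerivAt.congr_deriv e5 ?_
    have : ∀ a b c : ℝ, a - 1 * b - ((2:ℕ):ℝ) * id s ^ (2 - 1) * 1 * (1 / 2 * c) = a - b - s * c := by
      intro a b c
      simp only [id]
      push_cast
      ring
    exact this _ _ _
  have := (convex_Icc (0:ℝ) 1).norm_image_sub_le_of_norm_hasDerivWithin_le (C := C * ‖y‖^3)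
      (fun s _ => (hk s).hasDerivWithinAt) (fun s hs => ?_)
      (Set.left_mem_Icc.2 zero_le_one) (Set.right_mem_Icc.2 zero_le_one)
  · simp at this
    convert this using 2
    ring
  · have hs1 : ‖s • y‖ ≤ ‖y‖ := by
      rw [norm_smul, Real.norm_of_nonneg hs.1]
      exact mul_le_of_le_one_left (norm_nonneg _) hs.2
    have := m2 (w + s • y) (by simpa [dist_eq_norm] using hs1)
    simp only [add_sub_cancel_left, map_smul] at this
    calc _ = ‖(fderiv ℝ f (w + s • y) - fderiv ℝ f w - s • fderiv ℝ (fderiv ℝ f) w y) y‖ := by simp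
      _ ≤ _ := ContinuousLinearMap.le_opNorm _ _
      _ ≤ (C * ‖y‖ * ‖y‖) * ‖y‖ := by
        gcongr
        exact this.trans (by gcongr)
      _ = _ := by ring

theorem gmm_deriv_nonneg {g : ℝ → ℝ} {d : ℝ} (h : HasDerivAt g d 0) (hg : ∀ t > 0, g 0 ≤ g t) :
    0 ≤ d := by
  have := h.hasDerivWithinAt (s := Set.Ioi 0)
  rw [hasDerivWithinAt_iff_tendsto_slope] at this
  simp only [Set.mem_Ioi, lt_self_iff_false, not_false_eq_true, Set.sdiff_singleton_eq_self] at this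
  refine ge_of_tendsto this ?_
  filter_upwards [self_mem_nhdsWithin] with t ht
  rw [slope_def_field]
  exact div_nonneg (sub_nonneg.2 (hg t ht)) (by simpa using (le_of_lt ht))

theorem gmm_sign {E : Type*} [NormedAddCommGroup E] [NormedSpace ℝ E] {f : E → ℝ}
    (hf : ContDiff ℝ 3 f) (w a b : E) (c : ℝ)
    (h : ∀ s : ℝ, s > 0 → ∀ t : ℝ, t > 0 → 0 ≤ c * (f (w + s • a + t • b) - f (w + s • a) - f (w + t • b) + f w)) :
    0 ≤ c * fderiv ℝ (fderiv ℝ f) w a b := by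
  have h1 : ContDiff ℝ 2 (fderiv ℝ f) := hf.fderiv_right (by norm_num)
  have key : ∀ s : ℝ, s > 0 → c * fderiv ℝ f w b ≤ c * fderiv ℝ f (w + s • a) b := by
    intro s hs
    have e : ∀ x, HasDerivAt (fun t : ℝ => f (x + t • b)) (fderiv ℝ f x b) 0 := by
      intro x
      have e1 : HasDerivAt (fun s : ℝ => x + s • b) b 0 := by
        simpa using ((hasDerivAt_id (0:ℝ)).smul_const b).const_add x
      have := ((hf.differentiable (by norm_num)) (x + (0:ℝ) • b)).hasFDerivAt.comp_hasDerivAt 0 e1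
      simp only [zero_smul, add_zero] at this
      exact this
    have := gmm_deriv_nonneg (((e (w + s • a)).sub (e w)).const_mul c) (fun t ht => by
      have := h s hs t ht
      simp only [Pi.sub_apply, zero_smul, add_zero]; nlinarith)
    nlinarith
  have e1 : HasDerivAt (fun s : ℝ => w + s • a) a 0 := by
    simpa using ((hasDerivAt_id (0:ℝ)).smul_const a).const_add w
  have e2 := ((h1.differentiable (by norm_num)) (w + (0:ℝ) • a)).hasFDerivAt.comp_hasDerivAt 0 e1
  have e3 := (e2.clm_apply (hasDerivAt_const (0:ℝ) b)).const_mul c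
  simp only [zero_smul, add_zero, Function.comp_apply, map_zero] at e3
  refine gmm_deriv_nonneg e3 (fun t ht => ?_)
  simpa using key t ht

/-- bounded derivatives up to order three -/
def GmmB {E : Type*} [NormedAddCommGroup E] [NormedSpace ℝ E] (f : E → ℝ) : Prop :=
  ContDiff ℝ 3 f ∧ ∃ C : ℝ, ∀ k ≤ 3, ∀ x, ‖iteratedFDeriv ℝ k f x‖ ≤ C

theorem GmmB.mul {E : Type*} [NormedAddCommGroup E] [NormedSpace ℝ E] {f g : E → ℝ}
    (hf : GmmB f) (hg : GmmB g) : GmmB (fun x => f x * g x) := by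
  obtain ⟨hf, C, hC⟩ := hf
  obtain ⟨hg, D, hD⟩ := hg
  have hC0 : 0 ≤ C := (norm_nonneg _).trans (hC 0 (by norm_num) 0)
  have hD0 : 0 ≤ D := (norm_nonneg _).trans (hD 0 (by norm_num) 0)
  refine ⟨hf.mul hg, ∑ i ∈ Finset.range (3 + 1), 8 * C * D, fun k hk x => ?_⟩
  refine (norm_iteratedFDeriv_mul_le hf hg x (by exact_mod_cast hk)).trans ?_
  refine (Finset.sum_le_sum (g := fun _ => 8 * C * D) fun i hi => ?_).trans
    (Finset.sum_le_sum_of_subset_of_nonneg (Finset.range_mono (by omega)) ?_)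
  · have h8 : (k.choose i : ℝ) ≤ 8 := by
      have : k.choose i ≤ 2 ^ k := Nat.choose_le_two_pow k i
      have h2 : 2 ^ k ≤ 2 ^ 3 := Nat.pow_le_pow_right (by norm_num) hk
      exact_mod_cast this.trans h2
    have := Finset.mem_range.1 hi
    gcongr
    · exact hC i (by omega) x
    · exact hD (k - i) (by omega) x
  · intros; positivity

theorem gmmB_const {E : Type*} [NormedAddCommGroup E] [NormedSpace ℝ E] (c : ℝ) :
    GmmB (fun _ : E => c) := by
  refine ⟨contDiff_const, |c|, fun k hk x => ?_⟩
  rcases k with _ | k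
  · simp
  · simp [iteratedFDeriv_succ_const]

theorem GmmB.one_sub {E : Type*} [NormedAddCommGroup E] [NormedSpace ℝ E] {f : E → ℝ}
    (hf : GmmB f) : GmmB (fun x => 1 - f x) := by
  obtain ⟨h1, D, hD⟩ := gmmB_const (E := E) 1
  obtain ⟨hf, C, hC⟩ := hf
  refine ⟨h1.sub hf, D + C, fun k hk x => ?_⟩
  have hk' : (k : WithTop ℕ∞) ≤ 3 := by exact_mod_cast hk
  have : iteratedFDeriv ℝ k (fun x => 1 - f x) x
      = iteratedFDeriv ℝ k (fun _ : E => (1:ℝ)) x - iteratedFDeriv ℝ k f x :=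
    iteratedFDeriv_sub_apply (h1.of_le hk').contDiffAt (hf.of_le hk').contDiffAt
  rw [this]
  exact (norm_sub_le _ _).trans (add_le_add (hD k hk x) (hC k hk x))

theorem GmmB.prod {E ι : Type*} [NormedAddCommGroup E] [NormedSpace ℝ E] {f : ι → E → ℝ}
    (hf : ∀ i, GmmB (f i)) (s : Finset ι) : GmmB (fun x => ∏ i ∈ s, f i x) := by
  classical
  induction s using Finset.induction with
  | empty => simpa using gmmB_const (E := E) 1
  | insert i s hi ih => simpa [Finset.prod_insert hi] using (hf i).mul ih

theorem GmmB.comp_clm {E F : Type*} [NormedAddCommGroup E] [NormedSpace ℝ E]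
    [NormedAddCommGroup F] [NormedSpace ℝ F] {f : F → ℝ}
    (hf : GmmB f) (L : E →L[ℝ] F) : GmmB (fun x => f (L x)) := by
  obtain ⟨hf, C, hC⟩ := hf
  have hC0 : 0 ≤ C := (norm_nonneg _).trans (hC 0 (by norm_num) 0)
  refine ⟨hf.comp L.contDiff, C * (1 + ‖L‖) ^ 3, fun k hk x => ?_⟩
  have := L.iteratedFDeriv_comp_right hf x (i := k) (by exact_mod_cast hk)
  change ‖iteratedFDeriv ℝ k (f ∘ L) x‖ ≤ _
  rw [this]
  refine (ContinuousMultilinearMap.norm_compContinuousLinearMap_le _ _).trans ?_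
  simp only [Finset.prod_const, Finset.card_univ, Fintype.card_fin]
  gcongr
  · exact hC k hk _
  · calc ‖L‖ ^ k ≤ (1 + ‖L‖) ^ k := by gcongr; linarith
      _ ≤ _ := pow_le_pow_right₀ (by linarith [norm_nonneg L]) hk

theorem gmm_sig_iter (a b : ℝ) (k : ℕ) (P : Polynomial ℝ) : ∃ Q : Polynomial ℝ,
    iteratedDeriv k (fun x => P.eval (Real.sigmoid (a * x + b)))
      = fun x => Q.eval (Real.sigmoid (a * x + b)) := by
  induction k generalizing P with
  | zero => exact ⟨P, by simp⟩
  | succ k ih =>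
    obtain ⟨Q, hQ⟩ := ih (P.derivative * (Polynomial.X * (1 - Polynomial.X)) * Polynomial.C a)
    refine ⟨Q, ?_⟩
    rw [iteratedDeriv_succ', ← hQ]
    congr 1
    ext x
    have e1 : HasDerivAt (fun x : ℝ => a * x + b) a x := by
      simpa using ((hasDerivAt_id x).const_mul a).add_const b
    have e2 := (Real.hasDerivAt_sigmoid (a * x + b)).comp x e1
    have e3 := (P.hasDerivAt (Real.sigmoid (a * x + b))).comp x e2
    have := e3.deriv
    simp only [Function.comp_def] at this
    rw [this]
    simp
    ring

theorem gmmB_sig (a b : ℝ) : GmmB (fun x : ℝ => Real.sigmoid (a * x + b)) := by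
  have hb : ∀ k : ℕ, ∃ C : ℝ, ∀ x, ‖iteratedFDeriv ℝ k (fun x : ℝ => Real.sigmoid (a * x + b)) x‖ ≤ C := by
    intro k
    obtain ⟨Q, hQ⟩ := gmm_sig_iter a b k Polynomial.X
    simp only [Polynomial.eval_X] at hQ
    obtain ⟨C, hC⟩ := (isCompact_Icc (a := (0:ℝ)) (b := 1)).exists_bound_of_continuousOn
      (f := fun x => Q.eval x) Q.continuous.continuousOn
    refine ⟨C, fun x => ?_⟩
    rw [norm_iteratedFDeriv_eq_norm_iteratedDeriv, hQ]
    exact hC _ ⟨Real.sigmoid_nonneg _, Real.sigmoid_le_one _⟩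
  choose C hC using hb
  refine ⟨?_, ∑ k ∈ Finset.range 4, |C k|, fun k hk x => ?_⟩
  · have : ContDiff ℝ 3 (fun x : ℝ => a * x + b) := by fun_prop
    exact (contDiff_sigmoid.of_le (by simp)).comp this
  · exact ((hC k x).trans (le_abs_self _)).trans (Finset.single_le_sum (f := fun k => |C k|)
      (fun _ _ => abs_nonneg _) (Finset.mem_range.2 (by omega)))

/-- the smoothed functional -/
noncomputable def gmmF {n m : ℕ} (h : ℝ → ℝ) (x : Fin n × Fin m → ℝ) : ℝ :=
  ∏ i, (1 - ∏ j, h (x (i, j)))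

theorem gmmB_F {n m : ℕ} {h : ℝ → ℝ} (hh : GmmB h) : GmmB (gmmF (n := n) (m := m) h) := by
  refine GmmB.prod (fun i => GmmB.one_sub (GmmB.prod (fun j => ?_) _)) _
  exact hh.comp_clm (ContinuousLinearMap.proj (R := ℝ) (φ := fun _ : Fin n × Fin m => ℝ) (i, j))

theorem gmmF_nonneg {n m : ℕ} {h : ℝ → ℝ} (h0 : ∀ x, 0 ≤ h x) (h1 : ∀ x, h x ≤ 1)
    (x : Fin n × Fin m → ℝ) : 0 ≤ gmmF h x :=
  Finset.prod_nonneg fun i _ => sub_nonneg.2 (Finset.prod_le_one (fun _ _ => h0 _) fun _ _ => h1 _)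

theorem gmmF_le_one {n m : ℕ} {h : ℝ → ℝ} (h0 : ∀ x, 0 ≤ h x) (h1 : ∀ x, h x ≤ 1)
    (x : Fin n × Fin m → ℝ) : gmmF h x ≤ 1 :=
  Finset.prod_le_one (fun i _ => sub_nonneg.2 (Finset.prod_le_one (fun _ _ => h0 _) fun _ _ => h1 _))
    (fun i _ => sub_le_self _ (Finset.prod_nonneg fun _ _ => h0 _))

theorem gmm_sd_same {n m : ℕ} {h : ℝ → ℝ} (hh : Antitone h) (h0 : ∀ x, 0 ≤ h x)
    (h1 : ∀ x, h x ≤ 1) (w : Fin n × Fin m → ℝ) (i : Fin n) (j k : Fin m) (hjk : j ≠ k)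
    (s t : ℝ) (hs : 0 ≤ s) (ht : 0 ≤ t) :
    gmmF h (w + s • Pi.single (i, j) 1 + t • Pi.single (i, k) 1) - gmmF h (w + s • Pi.single (i, j) 1)
      - gmmF h (w + t • Pi.single (i, k) 1) + gmmF h w ≤ 0 := by
  set R := ∏ i' ∈ Finset.univ.erase i, (1 - ∏ j, h (w (i', j))) with hR
  set c := ∏ j' ∈ (Finset.univ.erase j).erase k, h (w (i, j')) with hc
  have key : ∀ s t : ℝ, gmmF h (w + s • Pi.single (i, j) 1 + t • Pi.single (i, k) 1)
      = (1 - h (w (i, j) + s) * (h (w (i, k) + t) * c)) * R := by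
    intro s t
    rw [gmmF, ← Finset.mul_prod_erase _ _ (Finset.mem_univ i)]
    congr 1
    · rw [← Finset.mul_prod_erase _ _ (Finset.mem_univ j),
        ← Finset.mul_prod_erase (Finset.univ.erase j) _
          (Finset.mem_erase.2 ⟨hjk.symm, Finset.mem_univ k⟩)]
      congr 3
      · simp [Pi.single_apply, hjk]
      · simp [Pi.single_apply, hjk.symm]
      · refine Finset.prod_congr rfl fun j' hj' => ?_
        simp only [Finset.mem_erase] at hj'
        simp [Pi.single_apply, hj'.1, hj'.2.1]
    · refine Finset.prod_congr rfl fun i' hi' => ?_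
      simp only [Finset.mem_erase] at hi'
      simp [Pi.single_apply, hi'.1]
  have k1 := key s t
  have k2 := key s 0
  have k3 := key 0 t
  have k4 := key 0 0
  simp only [zero_smul, add_zero] at k2 k3 k4
  rw [k1, k2, k3, k4]
  have hR0 : 0 ≤ R := Finset.prod_nonneg fun i _ =>
    sub_nonneg.2 (Finset.prod_le_one (fun _ _ => h0 _) fun _ _ => h1 _)
  have hc0 : 0 ≤ c := Finset.prod_nonneg fun i _ => h0 _
  have a1 : 0 ≤ h (w (i, j)) - h (w (i, j) + s) := sub_nonneg.2 (hh (by linarith))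
  have a2 : 0 ≤ h (w (i, k)) - h (w (i, k) + t) := sub_nonneg.2 (hh (by linarith))
  have := mul_nonneg (mul_nonneg a1 a2) (mul_nonneg hc0 hR0)
  nlinarith

theorem gmm_sd_diff {n m : ℕ} {h : ℝ → ℝ} (hh : Antitone h) (h0 : ∀ x, 0 ≤ h x)
    (h1 : ∀ x, h x ≤ 1) (w : Fin n × Fin m → ℝ) (i l : Fin n) (hil : i ≠ l) (j k : Fin m)
    (s t : ℝ) (hs : 0 ≤ s) (ht : 0 ≤ t) :
    0 ≤ gmmF h (w + s • Pi.single (i, j) 1 + t • Pi.single (l, k) 1)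
      - gmmF h (w + s • Pi.single (i, j) 1) - gmmF h (w + t • Pi.single (l, k) 1) + gmmF h w := by
  set R := ∏ i' ∈ (Finset.univ.erase i).erase l, (1 - ∏ j, h (w (i', j))) with hR
  have row : ∀ (i : Fin n) (j : Fin m) (s : ℝ), ∏ j', h ((w + s • Pi.single (i, j) 1 : Fin n × Fin m → ℝ) (i, j')) =
      h (w (i, j) + s) * ∏ j' ∈ Finset.univ.erase j, h (w (i, j')) := by
    intro i j s
    rw [← Finset.mul_prod_erase _ _ (Finset.mem_univ j)]
    congr 1
    · simp
    · refine Finset.prod_congr rfl fun j' hj' => ?_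
      simp only [Finset.mem_erase] at hj'
      simp [Pi.single_apply, hj'.1]
  set c := ∏ j' ∈ Finset.univ.erase j, h (w (i, j')) with hc
  set d := ∏ j' ∈ Finset.univ.erase k, h (w (l, j')) with hd
  have key : ∀ s t : ℝ, gmmF h (w + s • Pi.single (i, j) 1 + t • Pi.single (l, k) 1)
      = (1 - h (w (i, j) + s) * c) * ((1 - h (w (l, k) + t) * d) * R) := by
    intro s t
    rw [gmmF, ← Finset.mul_prod_erase _ _ (Finset.mem_univ i),
        ← Finset.mul_prod_erase (Finset.univ.erase i) _
          (Finset.mem_erase.2 ⟨hil.symm, Finset.mem_univ l⟩), hc, hd, ← row, ← row]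
    congr 2
    · refine Finset.prod_congr rfl fun j' hj' => ?_
      simp [Pi.single_apply, hil]
    · refine congrArg (fun x => 1 - x) (Finset.prod_congr rfl fun j' hj' => ?_)
      simp [Pi.single_apply, hil.symm]
    · refine Finset.prod_congr rfl fun i' hi' => ?_
      simp only [Finset.mem_erase] at hi'
      simp [Pi.single_apply, hi'.1, hi'.2.1]
  have k1 := key s t
  have k2 := key s 0
  have k3 := key 0 t
  have k4 := key 0 0
  simp only [zero_smul, add_zero] at k2 k3 k4
  rw [k1, k2, k3, k4]
  have hR0 : 0 ≤ R := Finset.prod_nonneg fun i _ =>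
    sub_nonneg.2 (Finset.prod_le_one (fun _ _ => h0 _) fun _ _ => h1 _)
  have hc0 : 0 ≤ c := Finset.prod_nonneg fun i _ => h0 _
  have hd0 : 0 ≤ d := Finset.prod_nonneg fun i _ => h0 _
  have a1 : 0 ≤ h (w (i, j)) - h (w (i, j) + s) := sub_nonneg.2 (hh (by linarith))
  have a2 : 0 ≤ h (w (l, k)) - h (w (l, k) + t) := sub_nonneg.2 (hh (by linarith))
  have := mul_nonneg (mul_nonneg (mul_nonneg a1 hc0) (mul_nonneg a2 hd0)) hR0
  nlinarith

theorem gmm_bilin {ι : Type*} [Fintype ι] [DecidableEq ι] (Q : (ι → ℝ) →L[ℝ] (ι → ℝ) →L[ℝ] ℝ)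
    (x : ι → ℝ) : Q x x = ∑ p, ∑ q, Q (Pi.single p 1) (Pi.single q 1) * (x p * x q) := by
  have hx : x = ∑ p, x p • (Pi.single p (1:ℝ) : ι → ℝ) := by
    ext i
    simp [Finset.sum_apply, Pi.single_apply]
  calc Q x x = Q (∑ p, x p • (Pi.single p (1:ℝ) : ι → ℝ)) (∑ p, x p • (Pi.single p (1:ℝ) : ι → ℝ)) := by
        rw [← hx]
    _ = _ := by
        simp only [map_sum, map_smul, ContinuousLinearMap.sum_apply, ContinuousLinearMap.smul_apply,
          smul_eq_mul, Finset.mul_sum]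
        rw [Finset.sum_comm]
        refine Finset.sum_congr rfl fun p _ => Finset.sum_congr rfl fun q _ => ?_
        ring

theorem gmm_int_taylor {ι : Type*} [Fintype ι] [DecidableEq ι] {f : (ι → ℝ) → ℝ}
    (hf : ContDiff ℝ 3 f) {C : ℝ} (hC : ∀ x, ‖iteratedFDeriv ℝ 3 f x‖ ≤ C)
    (hb : ∃ D, ∀ x, ‖f x‖ ≤ D)
    (μ : Measure (ι → ℝ)) [IsGaussian μ] (h0 : ∀ L : StrongDual ℝ (ι → ℝ), ∫ x, L x ∂μ = 0)
    (w : ι → ℝ) {δ : ℝ} (hδ : 0 ≤ δ) :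
    |∫ x, f (w + δ • x) ∂μ - f w - δ ^ 2 / 2 * ∑ p, ∑ q,
      fderiv ℝ (fderiv ℝ f) w (Pi.single p 1) (Pi.single q 1) * ∫ x, x p * x q ∂μ|
      ≤ C * δ ^ 3 * ∫ x, ‖x‖ ^ 3 ∂μ := by
  obtain ⟨D, hD⟩ := hb
  have hmem : ∀ p, MemLp (fun x : ι → ℝ => x p) 2 μ := fun p =>
    IsGaussian.memLp_dual μ (ContinuousLinearMap.proj (R := ℝ) (φ := fun _ : ι => ℝ) p) 2 (by simp)
  have hpq : ∀ p q, Integrable (fun x : ι → ℝ => x p * x q) μ := fun p q =>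
    (hmem p).integrable_mul (hmem q)
  have i3 : Integrable (fun x : ι → ℝ => ‖x‖ ^ 3) μ := by
    have := (IsGaussian.memLp_id μ 3 (by simp)).integrable_norm_pow (by norm_num)
    simpa using this
  have i1 : Integrable (fun x : ι → ℝ => f (w + δ • x)) μ := by
    refine Integrable.of_bound (C := D) ?_ (Filter.Eventually.of_forall fun x => hD _)
    exact (hf.continuous.comp (by fun_prop)).aestronglyMeasurable
  set Q := fderiv ℝ (fderiv ℝ f) w with hQ
  have i2 : Integrable (fun x : ι → ℝ => fderiv ℝ f w (δ • x)) μ := by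
    simp only [map_smul]
    exact (IsGaussian.integrable_dual μ (fderiv ℝ f w)).const_mul δ
  have e4 : ∀ x : ι → ℝ, (1/2) * Q (δ • x) (δ • x) = δ ^ 2 / 2 * ∑ p, ∑ q,
      Q (Pi.single p 1) (Pi.single q 1) * (x p * x q) := by
    intro x
    rw [← gmm_bilin]
    simp only [map_smul, ContinuousLinearMap.smul_apply, smul_eq_mul]
    ring
  have i5 : Integrable (fun x : ι → ℝ => ∑ p, ∑ q,
      Q (Pi.single p 1) (Pi.single q 1) * (x p * x q)) μ :=
    integrable_finsetSum _ fun p _ => integrable_finsetSum _ fun q _ => (hpq p q).const_mul _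
  have i4 : Integrable (fun x : ι → ℝ => (1/2) * Q (δ • x) (δ • x)) μ := by
    simp only [e4]
    exact i5.const_mul _
  have hm : ∫ x : ι → ℝ, fderiv ℝ f w (δ • x) ∂μ = 0 := by
    simp only [map_smul, smul_eq_mul]
    rw [integral_const_mul, h0, mul_zero]
  have hq : ∫ x : ι → ℝ, (1/2) * Q (δ • x) (δ • x) ∂μ = δ ^ 2 / 2 * ∑ p, ∑ q,
      Q (Pi.single p 1) (Pi.single q 1) * ∫ x, x p * x q ∂μ := by
    simp only [e4]
    rw [integral_const_mul, integral_finsetSum _ fun p _ => integrable_finsetSum _ fun q _ =>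
      (hpq p q).const_mul _]
    congr 1
    refine Finset.sum_congr rfl fun p _ => ?_
    rw [integral_finsetSum _ fun q _ => (hpq p q).const_mul _]
    refine Finset.sum_congr rfl fun q _ => ?_
    rw [integral_const_mul]
  have : ∫ x, f (w + δ • x) ∂μ - f w - δ ^ 2 / 2 * ∑ p, ∑ q,
      Q (Pi.single p 1) (Pi.single q 1) * ∫ x, x p * x q ∂μ
      = ∫ x, (f (w + δ • x) - f w - fderiv ℝ f w (δ • x) - (1/2) * Q (δ • x) (δ • x)) ∂μ := by
    have j1 : Integrable (fun x => f (w + δ • x) - f w) μ := i1.sub (integrable_const _)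
    have j2 : Integrable (fun x => f (w + δ • x) - f w - fderiv ℝ f w (δ • x)) μ := j1.sub i2
    rw [integral_sub j2 i4, integral_sub j1 i2, integral_sub i1 (integrable_const _), hm, hq]
    simp
  rw [this, ← integral_const_mul, ← Real.norm_eq_abs]
  refine norm_integral_le_of_norm_le (i3.const_mul _) (Filter.Eventually.of_forall fun x => ?_)
  refine (gmm_taylor hf hC w (δ • x)).trans (le_of_eq ?_)
  rw [norm_smul, Real.norm_of_nonneg hδ]
  ring

/-- comparison step, pointwise -/
theorem gmm_step {ι : Type*} [Fintype ι] [DecidableEq ι] {f : (ι → ℝ) → ℝ} (hf : GmmB f)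
    (μ ν : Measure (ι → ℝ)) [IsGaussian μ] [IsGaussian ν]
    (hμ : ∀ L : StrongDual ℝ (ι → ℝ), ∫ x, L x ∂μ = 0)
    (hν : ∀ L : StrongDual ℝ (ι → ℝ), ∫ x, L x ∂ν = 0)
    (hs : ∀ w p q, 0 ≤ (∫ x, x p * x q ∂ν - ∫ x, x p * x q ∂μ) *
      fderiv ℝ (fderiv ℝ f) w (Pi.single p 1) (Pi.single q 1)) :
    ∃ K, ∀ w, ∀ δ : ℝ, 0 ≤ δ →
      ∫ x, f (w + δ • x) ∂μ ≤ ∫ x, f (w + δ • x) ∂ν + K * δ ^ 3 := by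
  obtain ⟨hf, C, hC⟩ := hf
  have hb : ∃ D, ∀ x, ‖f x‖ ≤ D := ⟨C, fun x => by simpa using hC 0 (by norm_num) x⟩
  refine ⟨C * ∫ x, ‖x‖ ^ 3 ∂μ + C * ∫ x, ‖x‖ ^ 3 ∂ν, fun w δ hδ => ?_⟩
  have a1 := abs_le.1 (gmm_int_taylor hf (hC 3 le_rfl) hb μ hμ w hδ)
  have a2 := abs_le.1 (gmm_int_taylor hf (hC 3 le_rfl) hb ν hν w hδ)
  have a3 : 0 ≤ ∑ p, ∑ q,
      fderiv ℝ (fderiv ℝ f) w (Pi.single p 1) (Pi.single q 1) * ∫ x, x p * x q ∂ν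
      - ∑ p, ∑ q,
      fderiv ℝ (fderiv ℝ f) w (Pi.single p 1) (Pi.single q 1) * ∫ x, x p * x q ∂μ := by
    simp only [← Finset.sum_sub_distrib]
    refine Finset.sum_nonneg fun p _ => Finset.sum_nonneg fun q _ => ?_
    have := hs w p q
    linarith
  have a4 := mul_nonneg (by positivity : 0 ≤ δ ^ 2 / 2) a3
  rw [mul_sub] at a4
  have := a1.2
  have := a2.1
  linarith

/-- scaled measure -/
noncomputable def gmmSc {ι : Type*} [Fintype ι] (a : ℝ) (μ : Measure (ι → ℝ)) : Measure (ι → ℝ) :=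
  μ.map (Real.sqrt a • ContinuousLinearMap.id ℝ (ι → ℝ))

instance gmmSc_gauss {ι : Type*} [Fintype ι] (a : ℝ) (μ : Measure (ι → ℝ)) [IsGaussian μ] :
    IsGaussian (gmmSc a μ) := by
  unfold gmmSc; infer_instance

theorem gmmSc_char {ι : Type*} [Fintype ι] {a : ℝ} (ha : 0 ≤ a) (μ : Measure (ι → ℝ))
    [IsGaussian μ] (hμ : ∀ L : StrongDual ℝ (ι → ℝ), ∫ x, L x ∂μ = 0)
    (L : StrongDual ℝ (ι → ℝ)) :
    charFunDual (gmmSc a μ) L = Complex.exp (-(a * Var[L; μ] / 2 : ℝ)) := by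
  rw [gmmSc, charFunDual_map, IsGaussian.charFunDual_eq, integral_complex_ofReal, hμ]
  have : Var[(L.comp (Real.sqrt a • ContinuousLinearMap.id ℝ (ι → ℝ)) : StrongDual ℝ (ι → ℝ)); μ]
      = a * Var[L; μ] := by
    have : ((L.comp (Real.sqrt a • ContinuousLinearMap.id ℝ (ι → ℝ)) : StrongDual ℝ (ι → ℝ)) :
        (ι → ℝ) → ℝ) = fun x => Real.sqrt a * L x := by
      ext x; simp
    rw [this, variance_const_mul, Real.sq_sqrt ha]
  rw [this]
  simp

/-- two parameter gaussian -/
noncomputable def gmmG {ι : Type*} [Fintype ι] (μ ν : Measure (ι → ℝ)) (a b : ℝ) :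
    Measure (ι → ℝ) := (gmmSc a μ).conv (gmmSc b ν)

instance gmmG_gauss {ι : Type*} [Fintype ι] (a b : ℝ) (μ ν : Measure (ι → ℝ)) [IsGaussian μ]
    [IsGaussian ν] : IsGaussian (gmmG μ ν a b) := by
  unfold gmmG; infer_instance

theorem gmmG_left {ι : Type*} [Fintype ι] {a b c : ℝ} (ha : 0 ≤ a) (hb : 0 ≤ b) (hc : 0 ≤ c)
    (μ ν : Measure (ι → ℝ)) [IsGaussian μ] [IsGaussian ν]
    (hμ : ∀ L : StrongDual ℝ (ι → ℝ), ∫ x, L x ∂μ = 0)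
    (hν : ∀ L : StrongDual ℝ (ι → ℝ), ∫ x, L x ∂ν = 0) :
    gmmG μ ν (a + c) b = (gmmG μ ν a b).conv (gmmSc c μ) := by
  refine Measure.ext_of_charFunDual (funext fun L => ?_)
  rw [gmmG, gmmG, charFunDual_conv, charFunDual_conv, charFunDual_conv,
    gmmSc_char (by positivity) μ hμ, gmmSc_char ha μ hμ, gmmSc_char hb ν hν, gmmSc_char hc μ hμ,
    ← Complex.exp_add, ← Complex.exp_add, ← Complex.exp_add]
  congr 1
  push_cast
  ring

theorem gmmG_right {ι : Type*} [Fintype ι] {a b c : ℝ} (ha : 0 ≤ a) (hb : 0 ≤ b) (hc : 0 ≤ c)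
    (μ ν : Measure (ι → ℝ)) [IsGaussian μ] [IsGaussian ν]
    (hμ : ∀ L : StrongDual ℝ (ι → ℝ), ∫ x, L x ∂μ = 0)
    (hν : ∀ L : StrongDual ℝ (ι → ℝ), ∫ x, L x ∂ν = 0) :
    gmmG μ ν a (b + c) = (gmmG μ ν a b).conv (gmmSc c ν) := by
  refine Measure.ext_of_charFunDual (funext fun L => ?_)
  rw [gmmG, gmmG, charFunDual_conv, charFunDual_conv, charFunDual_conv,
    gmmSc_char (by positivity) ν hν, gmmSc_char ha μ hμ, gmmSc_char hb ν hν, gmmSc_char hc ν hν,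
    ← Complex.exp_add, ← Complex.exp_add, ← Complex.exp_add]
  congr 1
  push_cast
  ring

theorem gmmG_10 {ι : Type*} [Fintype ι] (μ ν : Measure (ι → ℝ)) [IsGaussian μ] [IsGaussian ν]
    (hμ : ∀ L : StrongDual ℝ (ι → ℝ), ∫ x, L x ∂μ = 0)
    (hν : ∀ L : StrongDual ℝ (ι → ℝ), ∫ x, L x ∂ν = 0) : gmmG μ ν 1 0 = μ := by
  refine Measure.ext_of_charFunDual (funext fun L => ?_)
  rw [gmmG, charFunDual_conv, gmmSc_char zero_le_one μ hμ, gmmSc_char le_rfl ν hν,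
    IsGaussian.charFunDual_eq, integral_complex_ofReal, hμ]
  simp

theorem gmmG_01 {ι : Type*} [Fintype ι] (μ ν : Measure (ι → ℝ)) [IsGaussian μ] [IsGaussian ν]
    (hμ : ∀ L : StrongDual ℝ (ι → ℝ), ∫ x, L x ∂μ = 0)
    (hν : ∀ L : StrongDual ℝ (ι → ℝ), ∫ x, L x ∂ν = 0) : gmmG μ ν 0 1 = ν := by
  refine Measure.ext_of_charFunDual (funext fun L => ?_)
  rw [gmmG, charFunDual_conv, gmmSc_char zero_le_one ν hν, gmmSc_char le_rfl μ hμ,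
    IsGaussian.charFunDual_eq, integral_complex_ofReal, hν]
  simp

theorem gmm_int_conv {ι : Type*} [Fintype ι] {f : (ι → ℝ) → ℝ} (hf : Continuous f)
    (hb : ∃ D, ∀ x, ‖f x‖ ≤ D) (W μ : Measure (ι → ℝ)) [IsGaussian μ] [IsGaussian W] (c : ℝ) :
    Integrable (fun w => ∫ x, f (w + Real.sqrt c • x) ∂μ) W ∧
    ∫ x, f x ∂(W.conv (gmmSc c μ)) = ∫ w, ∫ x, f (w + Real.sqrt c • x) ∂μ ∂W := by
  obtain ⟨D, hD⟩ := hb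
  constructor
  · refine Integrable.of_bound (C := D) ?_ (Filter.Eventually.of_forall fun w => ?_)
    · have : StronglyMeasurable (fun w : (ι → ℝ) × (ι → ℝ) => f (w.1 + Real.sqrt c • w.2)) :=
        (hf.comp (by fun_prop)).stronglyMeasurable
      exact this.integral_prod_right.aestronglyMeasurable
    · refine (norm_integral_le_of_norm_le_const (Filter.Eventually.of_forall fun x => hD _)).trans ?_
      simp
  · rw [integral_conv]
    · refine integral_congr_ae (Filter.Eventually.of_forall fun w => ?_)
      simp only [gmmSc]
      have hm : Continuous (fun y : ι → ℝ => f (w + y)) := hf.comp (by fun_prop)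
      rw [integral_map (by fun_prop) hm.aestronglyMeasurable]
      simp
    · exact Integrable.of_bound (C := D) hf.aestronglyMeasurable (Filter.Eventually.of_forall hD)

theorem gmm_compare {ι : Type*} [Fintype ι] [DecidableEq ι] {f : (ι → ℝ) → ℝ} (hf : GmmB f)
    (μ ν : Measure (ι → ℝ)) [IsGaussian μ] [IsGaussian ν]
    (hμ : ∀ L : StrongDual ℝ (ι → ℝ), ∫ x, L x ∂μ = 0)
    (hν : ∀ L : StrongDual ℝ (ι → ℝ), ∫ x, L x ∂ν = 0)
    (hs : ∀ w p q, 0 ≤ (∫ x, x p * x q ∂ν - ∫ x, x p * x q ∂μ) *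
      fderiv ℝ (fderiv ℝ f) w (Pi.single p 1) (Pi.single q 1)) :
    ∫ x, f x ∂μ ≤ ∫ x, f x ∂ν := by
  obtain ⟨K, hK⟩ := gmm_step hf μ ν hμ hν hs
  obtain ⟨hf, C, hC⟩ := hf
  have hb : ∃ D, ∀ x, ‖f x‖ ≤ D := ⟨C, fun x => by simpa using hC 0 (by norm_num) x⟩
  have hc := hf.continuous
  have step : ∀ a b c : ℝ, 0 ≤ a → 0 ≤ b → 0 ≤ c →
      ∫ x, f x ∂(gmmG μ ν (a + c) b) ≤ ∫ x, f x ∂(gmmG μ ν a (b + c)) + K * Real.sqrt c ^ 3 := by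
    intro a b c ha hb' hc'
    rw [gmmG_left ha hb' hc' μ ν hμ hν, gmmG_right ha hb' hc' μ ν hμ hν]
    obtain ⟨j1, e1⟩ := gmm_int_conv hc hb (gmmG μ ν a b) μ c
    obtain ⟨j2, e2⟩ := gmm_int_conv hc hb (gmmG μ ν a b) ν c
    rw [e1, e2]
    have : ∫ w, ∫ x, f (w + Real.sqrt c • x) ∂ν ∂(gmmG μ ν a b) + K * Real.sqrt c ^ 3
      = ∫ w, (∫ x, f (w + Real.sqrt c • x) ∂ν + K * Real.sqrt c ^ 3) ∂(gmmG μ ν a b) := by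
      rw [integral_add j2 (integrable_const _)]; simp
    rw [this]
    exact integral_mono j1 (j2.add (integrable_const _)) fun w => hK w _ (Real.sqrt_nonneg c)
  have main : ∀ N : ℕ, ∫ x, f x ∂μ ≤ ∫ x, f x ∂ν + K * (1 / Real.sqrt ((N:ℝ) + 1)) := by
    intro N
    set c : ℝ := 1 / ((N:ℝ) + 1) with hcdef
    have hc0 : 0 ≤ c := by positivity
    have hNc : ((N:ℝ) + 1) * c = 1 := by rw [hcdef]; field_simp
    have ind : ∀ k : ℕ, k ≤ N + 1 → ∫ x, f x ∂μ ≤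
        ∫ x, f x ∂(gmmG μ ν (((N:ℝ) + 1 - k) * c) (k * c)) + k * (K * Real.sqrt c ^ 3) := by
      intro k
      induction k with
      | zero => intro _; simp [hNc, gmmG_10 μ ν hμ hν]
      | succ k ih =>
        intro hk
        have hk' : (k:ℝ) + 1 ≤ N + 1 := by exact_mod_cast hk
        have h1 := ih (by omega)
        have h2 := step (((N:ℝ) + 1 - (k + 1)) * c) (k * c) c
          (mul_nonneg (by linarith) hc0) (by positivity) hc0
        rw [show ((N:ℝ) + 1 - (k + 1)) * c + c = ((N:ℝ) + 1 - k) * c by ring,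
          show (k:ℝ) * c + c = (k + 1) * c by ring] at h2
        push_cast
        linarith
    have := ind (N + 1) le_rfl
    push_cast at this
    rw [sub_self, zero_mul, hNc, gmmG_01 μ ν hμ hν] at this
    refine this.trans (le_of_eq ?_)
    congr 1
    have hsq : Real.sqrt c ^ 3 = c * Real.sqrt c := by
      rw [pow_succ, Real.sq_sqrt hc0]
    rw [hsq, show ((N:ℝ) + 1) * (K * (c * Real.sqrt c)) = (((N:ℝ) + 1) * c) * (K * Real.sqrt c) by ring,
      hNc, one_mul, hcdef, Real.sqrt_div zero_le_one, Real.sqrt_one]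
  have lim : Filter.Tendsto (fun N : ℕ => ∫ x, f x ∂ν + K * (1 / Real.sqrt ((N:ℝ) + 1)))
      Filter.atTop (nhds (∫ x, f x ∂ν + K * 0)) := by
    refine tendsto_const_nhds.add (Filter.Tendsto.const_mul K ?_)
    simp only [one_div]
    refine Filter.Tendsto.inv_tendsto_atTop (Real.tendsto_sqrt_atTop.comp ?_)
    exact Filter.tendsto_atTop_add_const_right _ _ tendsto_natCast_atTop_atTop
  simpa using ge_of_tendsto' lim main

theorem gmm_law {Ω ι : Type*} [MeasureSpace Ω] [Fintype ι] [DecidableEq ι]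
    {X : ι → Ω → ℝ} (hm : ∀ p, Measurable (X p)) (hX : IsCenteredGaussianFamily X) :
    IsGaussian (Measure.map (fun ω p => X p ω) (volume : Measure Ω)) ∧
    ∀ L : StrongDual ℝ (ι → ℝ),
      ∫ x, L x ∂(Measure.map (fun ω p => X p ω) (volume : Measure Ω)) = 0 := by
  have hZ : Measurable (fun ω p => X p ω) := measurable_pi_lambda _ hm
  have key : ∀ L : (ι → ℝ) →L[ℝ] ℝ, ∃ v : NNReal,
      (Measure.map (fun ω p => X p ω) (volume : Measure Ω)).map L = gaussianReal 0 v := by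
    intro L
    obtain ⟨v, hv⟩ := hX (fun p => L (Pi.single p 1))
    refine ⟨v, ?_⟩
    rw [← hv, Measure.map_map (by fun_prop) hZ]
    congr 1
    ext ω
    have hx : (fun p => X p ω) = ∑ p, X p ω • (Pi.single p (1:ℝ) : ι → ℝ) := by
      ext i
      simp [Finset.sum_apply, Pi.single_apply]
    simp only [Function.comp_apply]
    rw [hx]
    simp [mul_comm]
  refine ⟨isGaussian_of_map_eq_gaussianReal fun L => ?_, fun L => ?_⟩
  · obtain ⟨v, hv⟩ := key L
    exact ⟨0, v, hv⟩
  · obtain ⟨v, hv⟩ := key L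
    have : ∫ y, y ∂((Measure.map (fun ω p => X p ω) (volume : Measure Ω)).map L) = 0 := by
      rw [hv, integral_id_gaussianReal]
    rwa [integral_map (by fun_prop) (by fun_prop)] at this

theorem gmm_sig_cmp
    {Ω : Type*} [MeasureSpace Ω] [IsProbabilityMeasure (volume : Measure Ω)]
    (n m : ℕ) (X Y : Fin n → Fin m → Ω → ℝ)
    (hXmeas : ∀ i j, Measurable (X i j)) (hYmeas : ∀ i j, Measurable (Y i j))
    (hXgauss : IsCenteredGaussianFamily (fun p : Fin n × Fin m => X p.1 p.2))
    (hYgauss : IsCenteredGaussianFamily (fun p : Fin n × Fin m => Y p.1 p.2))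
    (h1 : ∀ i j, ∫ ω, X i j ω * X i j ω = ∫ ω, Y i j ω * Y i j ω)
    (h2 : ∀ i j k, ∫ ω, Y i j ω * Y i k ω ≤ ∫ ω, X i j ω * X i k ω)
    (h3 : ∀ i l j k, i ≠ l → ∫ ω, X i j ω * X l k ω ≤ ∫ ω, Y i j ω * Y l k ω)
    (a b : ℝ) (ha : a ≤ 0) :
    ∫ ω, gmmF (fun x => Real.sigmoid (a * x + b)) (fun p : Fin n × Fin m => X p.1 p.2 ω) ≤
    ∫ ω, gmmF (fun x => Real.sigmoid (a * x + b)) (fun p : Fin n × Fin m => Y p.1 p.2 ω) := by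
  set h : ℝ → ℝ := fun x => Real.sigmoid (a * x + b) with hh
  have hanti : Antitone h := fun x y hxy =>
    Real.sigmoid_monotone (by nlinarith [mul_le_mul_of_nonpos_left hxy ha])
  have hh0 : ∀ x, 0 ≤ h x := fun x => Real.sigmoid_nonneg _
  have hh1 : ∀ x, h x ≤ 1 := fun x => Real.sigmoid_le_one _
  have hB : GmmB (gmmF (n := n) (m := m) h) := gmmB_F (gmmB_sig a b)
  obtain ⟨gX, cX⟩ := gmm_law (fun p : Fin n × Fin m => hXmeas p.1 p.2) hXgauss
  obtain ⟨gY, cY⟩ := gmm_law (fun p : Fin n × Fin m => hYmeas p.1 p.2) hYgauss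
  have mX : Measurable (fun ω (p : Fin n × Fin m) => X p.1 p.2 ω) :=
    measurable_pi_lambda _ fun p => hXmeas p.1 p.2
  have mY : Measurable (fun ω (p : Fin n × Fin m) => Y p.1 p.2 ω) :=
    measurable_pi_lambda _ fun p => hYmeas p.1 p.2
  have := gmm_compare hB _ _ cX cY ?_
  · rwa [integral_map mX.aemeasurable hB.1.continuous.aestronglyMeasurable,
      integral_map mY.aemeasurable hB.1.continuous.aestronglyMeasurable] at this
  · rintro w ⟨i, j⟩ ⟨l, k⟩
    have hc : Continuous (fun x : Fin n × Fin m → ℝ => x (i, j) * x (l, k)) := by fun_prop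
    rw [integral_map mX.aemeasurable hc.aestronglyMeasurable,
      integral_map mY.aemeasurable hc.aestronglyMeasurable]
    simp only
    by_cases hil : i = l
    · subst hil
      by_cases hjk : j = k
      · subst hjk
        rw [h1, sub_self, zero_mul]
      · refine mul_nonneg_of_nonpos_of_nonpos (sub_nonpos.2 (h2 i j k)) ?_
        have := gmm_sign hB.1 w (Pi.single (i, j) 1) (Pi.single (i, k) 1) (-1) (fun s hs t ht => by
          have := gmm_sd_same hanti hh0 hh1 w i j k hjk s t hs.le ht.le
          linarith)
        linarith
    · refine mul_nonneg (sub_nonneg.2 (h3 i l j k hil)) ?_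
      have := gmm_sign hB.1 w (Pi.single (i, j) 1) (Pi.single (l, k) 1) 1 (fun s hs t ht => by
          have := gmm_sd_diff hanti hh0 hh1 w i l hil j k s t hs.le ht.le
          linarith)
      linarith

theorem gmm_lower_seq (S : Set ℝ) (hS : IsLowerSet S) : ∃ a b : ℕ → ℝ, (∀ k, a k ≤ 0) ∧
    (∀ x ∈ S, Filter.Tendsto (fun k => a k * x + b k) Filter.atTop Filter.atTop) ∧
    (∀ x, x ∉ S → Filter.Tendsto (fun k => a k * x + b k) Filter.atTop Filter.atBot) := by
  have hN : Filter.Tendsto (fun k : ℕ => (k:ℝ)) Filter.atTop Filter.atTop :=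
    tendsto_natCast_atTop_atTop
  by_cases hE : S = ∅
  · refine ⟨fun _ => 0, fun k => -k, by simp, by simp [hE], fun x _ => ?_⟩
    simpa using hN
  by_cases hU : S = Set.univ
  · refine ⟨fun _ => 0, fun k => k, by simp, fun x _ => ?_, by simp [hU]⟩
    simpa using hN
  have hne : S.Nonempty := Set.nonempty_iff_ne_empty.2 hE
  obtain ⟨z, hz⟩ := (Set.ne_univ_iff_exists_notMem S).1 hU
  have hbd : BddAbove S := ⟨z, fun x hx => by
    by_contra hlt
    exact hz (hS (not_le.1 hlt).le hx)⟩
  set c := sSup S with hc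
  have up : ∀ x, c < x → x ∉ S := fun x hx hxS => absurd (le_csSup hbd hxS) (not_le.2 hx)
  have lo : ∀ x, x < c → x ∈ S := fun x hx => by
    obtain ⟨y, hy, hxy⟩ := exists_lt_of_lt_csSup hne hx
    exact hS hxy.le hy
  have T1 : ∀ d : ℝ, 0 ≤ d →
      Filter.Tendsto (fun k : ℕ => (k:ℝ) * (k * d + 1)) Filter.atTop Filter.atTop := by
    intro d hd
    refine Filter.tendsto_atTop_mono (fun k => ?_) hN
    have : (0:ℝ) ≤ k * (k * d) := by positivity
    nlinarith
  have T2 : ∀ d : ℝ, 0 < d →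
      Filter.Tendsto (fun k : ℕ => (k:ℝ) * (k * d - 1)) Filter.atTop Filter.atTop := by
    intro d hd
    exact hN.atTop_mul_atTop₀ (Filter.tendsto_atTop_add_const_right _ _ (hN.atTop_mul_const hd))
  by_cases hcS : c ∈ S
  · refine ⟨fun k => -(k:ℝ)^2, fun k => (k:ℝ)^2 * c + k, fun k => by simp,
      fun x hx => ?_, fun x hx => ?_⟩
    · refine (T1 (c - x) (sub_nonneg.2 (le_csSup hbd hx))).congr fun k => ?_
      ring
    · have : c < x := lt_of_not_ge fun hle => hx (hS hle hcS)
      refine (Filter.tendsto_neg_atTop_atBot.comp (T2 (x - c) (sub_pos.2 this))).congr fun k => ?_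
      simp only [Function.comp_apply]
      ring
  · refine ⟨fun k => -(k:ℝ)^2, fun k => (k:ℝ)^2 * c - k, fun k => by simp,
      fun x hx => ?_, fun x hx => ?_⟩
    · have : x < c := lt_of_le_of_ne (le_csSup hbd hx) (fun h => hcS (h ▸ hx))
      refine (T2 (c - x) (sub_pos.2 this)).congr fun k => ?_
      ring
    · have : c ≤ x := le_of_not_gt fun hlt => hx (lo x hlt)
      refine (Filter.tendsto_neg_atTop_atBot.comp (T1 (x - c) (sub_nonneg.2 this))).congr fun k => ?_
      simp only [Function.comp_apply]
      ring

theorem gmm_event_meas {Ω : Type*} [MeasurableSpace Ω] {n m : ℕ} {X : Fin n → Fin m → Ω → ℝ}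
    (hX : ∀ i j, Measurable (X i j)) {S : Set ℝ} (hS : IsLowerSet S) :
    MeasurableSet {ω | ∃ i, ∀ j, X i j ω ∈ S} := by
  have hSm : MeasurableSet S := hS.ordConnected.measurableSet
  have : {ω | ∃ i, ∀ j, X i j ω ∈ S} = ⋃ i, ⋂ j, X i j ⁻¹' S := by ext; simp
  rw [this]
  exact MeasurableSet.iUnion fun i => MeasurableSet.iInter fun j => hX i j hSm

theorem gmm_F_ind {n m : ℕ} (S : Set ℝ) (x : Fin n × Fin m → ℝ) [Decidable (∃ i, ∀ j, x (i, j) ∈ S)] :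
    gmmF (S.indicator fun _ => 1) x = if ∃ i, ∀ j, x (i, j) ∈ S then 0 else 1 := by
  classical
  unfold gmmF
  split_ifs with h
  · obtain ⟨i, hi⟩ := h
    refine Finset.prod_eq_zero (Finset.mem_univ i) ?_
    simp [Set.indicator, hi]
  · push Not at h
    refine Finset.prod_eq_one fun i _ => ?_
    obtain ⟨j, hj⟩ := h i
    rw [Finset.prod_eq_zero (Finset.mem_univ j) (by simp [hj])]
    simp

theorem gmm_event
    {Ω : Type*} [MeasureSpace Ω] [IsProbabilityMeasure (volume : Measure Ω)]
    (n m : ℕ) (X Y : Fin n → Fin m → Ω → ℝ)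
    (hXmeas : ∀ i j, Measurable (X i j)) (hYmeas : ∀ i j, Measurable (Y i j))
    (hXgauss : IsCenteredGaussianFamily (fun p : Fin n × Fin m => X p.1 p.2))
    (hYgauss : IsCenteredGaussianFamily (fun p : Fin n × Fin m => Y p.1 p.2))
    (h1 : ∀ i j, ∫ ω, X i j ω * X i j ω = ∫ ω, Y i j ω * Y i j ω)
    (h2 : ∀ i j k, ∫ ω, Y i j ω * Y i k ω ≤ ∫ ω, X i j ω * X i k ω)
    (h3 : ∀ i l j k, i ≠ l → ∫ ω, X i j ω * X l k ω ≤ ∫ ω, Y i j ω * Y l k ω)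
    (S : Set ℝ) (hS : IsLowerSet S) :
    volume {ω | ∃ i, ∀ j, X i j ω ∈ S}ᶜ ≤ volume {ω | ∃ i, ∀ j, Y i j ω ∈ S}ᶜ := by
  classical
  obtain ⟨a, b, ha, hin, hout⟩ := gmm_lower_seq S hS
  have lim : ∀ (Z : Fin n → Fin m → Ω → ℝ), (∀ i j, Measurable (Z i j)) →
      Filter.Tendsto (fun k => ∫ ω, gmmF (fun x => Real.sigmoid (a k * x + b k))
        (fun p : Fin n × Fin m => Z p.1 p.2 ω)) Filter.atTop
        (nhds (volume.real {ω | ∃ i, ∀ j, Z i j ω ∈ S}ᶜ)) := by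
    intro Z hZ
    have mZ : Measurable (fun ω (p : Fin n × Fin m) => Z p.1 p.2 ω) :=
      measurable_pi_lambda _ fun p => hZ p.1 p.2
    have : volume.real {ω | ∃ i, ∀ j, Z i j ω ∈ S}ᶜ =
        ∫ ω, gmmF (S.indicator fun _ => 1) (fun p : Fin n × Fin m => Z p.1 p.2 ω) := by
      rw [← integral_indicator_one (gmm_event_meas hZ hS).compl]
      refine integral_congr_ae (Filter.Eventually.of_forall fun ω => ?_)
      simp only [gmm_F_ind]
      by_cases h : ∃ i, ∀ j, Z i j ω ∈ S
      · simp only [Set.indicator, h]; simp [h]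
      · simp only [Set.indicator, h]; simp [h]
    rw [this]
    refine tendsto_integral_of_dominated_convergence (fun _ => (1:ℝ)) (fun k => ?_)
      (integrable_const _) (fun k => Filter.Eventually.of_forall fun ω => ?_)
      (Filter.Eventually.of_forall fun ω => ?_)
    · exact ((gmmB_F (gmmB_sig (a k) (b k))).1.continuous.measurable.comp mZ).aestronglyMeasurable
    · rw [Real.norm_of_nonneg (gmmF_nonneg (fun _ => Real.sigmoid_nonneg _)
        (fun _ => Real.sigmoid_le_one _) _)]
      exact gmmF_le_one (fun _ => Real.sigmoid_nonneg _) (fun _ => Real.sigmoid_le_one _) _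
    · refine tendsto_finsetProd _ fun i _ => tendsto_const_nhds.sub (tendsto_finsetProd _ fun j _ => ?_)
      by_cases h : Z i j ω ∈ S
      · simpa [h, Function.comp_def] using Real.tendsto_sigmoid_atTop.comp (hin _ h)
      · simpa [h, Function.comp_def] using Real.tendsto_sigmoid_atBot.comp (hout _ h)
  have := le_of_tendsto_of_tendsto' (lim X hXmeas) (lim Y hYmeas) fun k =>
    gmm_sig_cmp n m X Y hXmeas hYmeas hXgauss hYgauss h1 h2 h3 (a k) (b k) (ha k)
  exact (ENNReal.toReal_le_toReal (measure_ne_top _ _) (measure_ne_top _ _)).1 this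

theorem gmm_lt_iff {n m : ℕ} (hn : 0 < n) (hm : 0 < m) (g : Fin n → Fin m → ℝ) (c : ℝ) :
    c < ⨆ i, ⨅ j, g i j ↔ ∃ i, ∀ j, c < g i j := by
  haveI : Nonempty (Fin n) := ⟨⟨0, hn⟩⟩
  haveI : Nonempty (Fin m) := ⟨⟨0, hm⟩⟩
  rw [lt_ciSup_iff (Set.finite_range _).bddAbove]
  refine exists_congr fun i => ⟨fun h j => h.trans_le (ciInf_le (Set.finite_range _).bddBelow j),
    fun h => ?_⟩
  obtain ⟨j, hj⟩ := exists_eq_ciInf_of_finite (f := g i)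
  rw [← hj]
  exact h j

theorem gmm_le_iff {n m : ℕ} (hn : 0 < n) (hm : 0 < m) (g : Fin n → Fin m → ℝ) (c : ℝ) :
    c ≤ ⨆ i, ⨅ j, g i j ↔ ∃ i, ∀ j, c ≤ g i j := by
  haveI : Nonempty (Fin n) := ⟨⟨0, hn⟩⟩
  haveI : Nonempty (Fin m) := ⟨⟨0, hm⟩⟩
  constructor
  · intro h
    obtain ⟨i, hi⟩ := exists_eq_ciSup_of_finite (f := fun i => ⨅ j, g i j)
    rw [← hi] at h
    exact ⟨i, fun j => h.trans (ciInf_le (Set.finite_range _).bddBelow j)⟩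
  · rintro ⟨i, hi⟩
    exact (le_ciInf hi).trans (le_ciSup (f := fun i => ⨅ j, g i j) (Set.finite_range _).bddAbove i)

theorem gmm_stoch {Ω : Type*} [MeasurableSpace Ω] {P : Measure Ω} {U V : Ω → ℝ}
    (hU : Integrable U P) (hV : Integrable V P)
    (h1 : ∀ c, P {ω | c < V ω} ≤ P {ω | c < U ω})
    (h2 : ∀ c, P {ω | U ω < c} ≤ P {ω | V ω < c}) : ∫ ω, V ω ∂P ≤ ∫ ω, U ω ∂P := by
  have gen : ∀ A B : Ω → ℝ, Integrable A P → Integrable B P →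
      (∀ c, P {ω | c < A ω} ≤ P {ω | c < B ω}) →
      ∫⁻ ω, ENNReal.ofReal (A ω) ∂P ≤ ∫⁻ ω, ENNReal.ofReal (B ω) ∂P := by
    intro A B hA hB h
    have e : ∀ A : Ω → ℝ, Integrable A P → ∫⁻ ω, ENNReal.ofReal (A ω) ∂P
        = ∫⁻ t in Set.Ioi (0:ℝ), P {ω | t < A ω} := by
      intro A hA
      have := lintegral_eq_lintegral_meas_lt P (f := fun ω => max (A ω) 0)
        (Filter.Eventually.of_forall fun ω => le_max_right _ _)
        (hA.aemeasurable.max aemeasurable_const)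
      have e0 : ∀ r : ℝ, ENNReal.ofReal (max r 0) = ENNReal.ofReal r := by
        intro r; simp [ENNReal.ofReal_max]
      simp only [e0] at this
      rw [this]
      refine setLIntegral_congr_fun measurableSet_Ioi fun t ht => ?_
      have ht' : (0:ℝ) < t := ht
      simp [lt_max_iff, not_lt.2 ht'.le]
    rw [e A hA, e B hB]
    exact lintegral_mono fun t => h t
  rw [integral_eq_lintegral_pos_part_sub_lintegral_neg_part hU,
    integral_eq_lintegral_pos_part_sub_lintegral_neg_part hV]
  have fin : ∀ A : Ω → ℝ, Integrable A P → ∫⁻ ω, ENNReal.ofReal (A ω) ∂P ≠ ⊤ :=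
    fun A hA => hA.lintegral_lt_top.ne
  refine sub_le_sub ?_ ?_
  · exact ENNReal.toReal_mono (fin U hU) (gen V U hV hU h1)
  · refine ENNReal.toReal_mono (fin _ hV.neg) (gen _ _ hU.neg hV.neg fun c => ?_)
    have := h2 (-c)
    simpa [lt_neg] using this

/-- Gordon's Gaussian comparison theorem (max-min form, nonincreasing `ψ`). -/
theorem gordon_max_min_nonincreasing
    {Ω : Type*} [MeasureSpace Ω] [IsProbabilityMeasure (volume : Measure Ω)]
    (n m : ℕ) (hn : 0 < n) (hm : 0 < m)
    (X Y : Fin n → Fin m → Ω → ℝ)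
    (hXmeas : ∀ i j, Measurable (X i j)) (hYmeas : ∀ i j, Measurable (Y i j))
    (hXgauss : IsCenteredGaussianFamily (fun p : Fin n × Fin m => X p.1 p.2))
    (hYgauss : IsCenteredGaussianFamily (fun p : Fin n × Fin m => Y p.1 p.2))
    (h1 : ∀ i j, ∫ ω, X i j ω * X i j ω = ∫ ω, Y i j ω * Y i j ω)
    (h2 : ∀ i j k, ∫ ω, Y i j ω * Y i k ω ≤ ∫ ω, X i j ω * X i k ω)
    (h3 : ∀ i l j k, i ≠ l → ∫ ω, X i j ω * X l k ω ≤ ∫ ω, Y i j ω * Y l k ω)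
    (ψ : ℝ → ℝ) (hψ : Antitone ψ)
    (hintX : Integrable (fun ω => ⨆ i, ⨅ j, ψ (X i j ω)))
    (hintY : Integrable (fun ω => ⨆ i, ⨅ j, ψ (Y i j ω))) :
    ∫ ω, ⨆ i, ⨅ j, ψ (Y i j ω) ≤ ∫ ω, ⨆ i, ⨅ j, ψ (X i j ω) := by
  refine gmm_stoch hintX hintY (fun c => ?_) (fun c => ?_)
  · have hS : IsLowerSet {x | c < ψ x} := fun x y hxy hx => lt_of_lt_of_le hx (hψ hxy)
    have := gmm_event n m X Y hXmeas hYmeas hXgauss hYgauss h1 h2 h3 _ hS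
    simp only [gmm_lt_iff hn hm]
    rw [prob_compl_eq_one_sub (gmm_event_meas hXmeas hS),
      prob_compl_eq_one_sub (gmm_event_meas hYmeas hS)] at this
    exact (ENNReal.sub_le_sub_iff_left prob_le_one ENNReal.one_ne_top).1 this
  · have hS : IsLowerSet {x | c ≤ ψ x} := fun x y hxy hx => le_trans hx (hψ hxy)
    have := gmm_event n m X Y hXmeas hYmeas hXgauss hYgauss h1 h2 h3 _ hS
    have e : ∀ g : Fin n → Fin m → Ω → ℝ, {ω | (⨆ i, ⨅ j, ψ (g i j ω)) < c}
        = {ω | ∃ i, ∀ j, g i j ω ∈ {x | c ≤ ψ x}}ᶜ := by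
      intro g
      ext ω
      simp only [Set.mem_setOf_eq, Set.mem_compl_iff, ← gmm_le_iff hn hm (fun i j => ψ (g i j ω)),
        not_le]
    rw [e, e]
    exact this
end
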